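/- arXiv:2501.11473 — 13 statements merged into one kernel-verified Lean document; each statement's English description precedes it below -/
import Mathlib

section
/- Let α > 1, let 𝒳 and 𝒴 be finite sets, and let K be a channel from 𝒳 to 𝒴. Suppose there exist x, x' ∈ 𝒳 such that the supports {y : K(y|x) > 0} and {y : K(y|x') > 0} are disjoint. Then the supremum, over all pairs (P, Q) of strictly positive probability distributions on 𝒳 with P ≠ Q, of the ratio D_α(K∘P ‖ K∘Q) / D_α(P ‖ Q) equals 1. -/
open Real

lemma aux_persp (α p q : ℝ) (hp : 0 ≤ p) (hq : 0 < q) :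
    p ^ α * q ^ (1 - α) = q * (p / q) ^ α := by
  rw [Real.div_rpow hp hq.le, Real.rpow_sub hq, Real.rpow_one]
  ring

lemma aux_jensen {X : Type*} [Fintype X] (α : ℝ) (hα : 1 < α) (c P Q : X → ℝ)
    (hc : ∀ z, 0 ≤ c z) (hP : ∀ z, 0 < P z) (hQ : ∀ z, 0 < Q z) :
    (∑ z, c z * P z) ^ α * (∑ z, c z * Q z) ^ (1 - α)
      ≤ ∑ z, c z * (P z ^ α * Q z ^ (1 - α)) := by
  have hS0 : 0 ≤ ∑ z, c z * Q z :=
    Finset.sum_nonneg fun z _ => mul_nonneg (hc z) (hQ z).le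
  rcases hS0.eq_or_lt with h | hS
  · have h1 : ∀ z, c z = 0 := by
      intro z
      have := (Finset.sum_eq_zero_iff_of_nonneg
        (fun z _ => mul_nonneg (hc z) (hQ z).le)).1 h.symm z (Finset.mem_univ z)
      rcases mul_eq_zero.1 this with h | h
      · exact h
      · exact absurd h (hQ z).ne'
    simp [h1, Real.zero_rpow (by linarith : α ≠ 0)]
  · set S := ∑ z, c z * Q z with hSdef
    have hp0 : 0 ≤ ∑ z, c z * P z :=
      Finset.sum_nonneg fun z _ => mul_nonneg (hc z) (hP z).le
    rw [aux_persp α _ _ hp0 hS]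
    have hJ := (convexOn_rpow hα.le).map_sum_le (t := Finset.univ)
      (w := fun z => c z * Q z / S) (p := fun z => P z / Q z)
      (fun z _ => div_nonneg (mul_nonneg (hc z) (hQ z).le) hS.le)
      (by rw [← Finset.sum_div, ← hSdef, div_self hS.ne'])
      (fun z _ => div_nonneg (hP z).le (hQ z).le)
    simp only [smul_eq_mul] at hJ
    have e1 : ∑ z, c z * Q z / S * (P z / Q z) = (∑ z, c z * P z) / S := by
      rw [Finset.sum_div]
      refine Finset.sum_congr rfl fun z _ => ?_
      have := (hQ z).ne'
      field_simp
    rw [e1] at hJ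
    calc _ ≤ S * ∑ z, c z * Q z / S * (P z / Q z) ^ α :=
          mul_le_mul_of_nonneg_left hJ hS.le
      _ = _ := by
          rw [Finset.mul_sum]
          refine Finset.sum_congr rfl fun z _ => ?_
          rw [aux_persp α _ _ (hP z).le (hQ z)]
          have := hS.ne'
          field_simp

lemma aux_dpi {X Y : Type*} [Fintype X] [Fintype Y] (α : ℝ) (hα : 1 < α)
    (K : X → Y → ℝ) (hK0 : ∀ x y, 0 ≤ K x y) (hK1 : ∀ x, ∑ y, K x y = 1)
    (P Q : X → ℝ) (hP : ∀ z, 0 < P z) (hQ : ∀ z, 0 < Q z) :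
    ∑ y, (∑ z, K z y * P z) ^ α * (∑ z, K z y * Q z) ^ (1 - α)
      ≤ ∑ z, P z ^ α * Q z ^ (1 - α) := by
  calc _ ≤ ∑ y, ∑ z, K z y * (P z ^ α * Q z ^ (1 - α)) :=
        Finset.sum_le_sum fun y _ => aux_jensen α hα (fun z => K z y) P Q (fun z => hK0 z y) hP hQ
    _ = _ := by
        rw [Finset.sum_comm]
        refine Finset.sum_congr rfl fun z _ => ?_
        rw [← Finset.sum_mul, hK1, one_mul]

lemma aux_nonneg {X Y : Type*} [Fintype X] (α : ℝ)
    (K : X → Y → ℝ) (hK0 : ∀ x y, 0 ≤ K x y)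
    (P Q : X → ℝ) (hP : ∀ z, 0 < P z) (hQ : ∀ z, 0 < Q z) (y : Y) :
    0 ≤ (∑ z, K z y * P z) ^ α * (∑ z, K z y * Q z) ^ (1 - α) :=
  mul_nonneg
    (Real.rpow_nonneg (Finset.sum_nonneg fun z _ => mul_nonneg (hK0 z y) (hP z).le) _)
    (Real.rpow_nonneg (Finset.sum_nonneg fun z _ => mul_nonneg (hK0 z y) (hQ z).le) _)

/-- If a channel `K` from a finite set `X` to a finite set `Y` has two input
symbols `x, x'` whose output supports are disjoint, then the supremum over pairs of strictly
positive distributions `P ≠ Q` on `X` of the ratio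
`D_α(K∘P ‖ K∘Q) / D_α(P ‖ Q)` equals `1`, for any `α > 1`. -/
theorem stmt_0 {X Y : Type*} [Fintype X] [Fintype Y] (α : ℝ) (hα : 1 < α)
    (K : X → Y → ℝ) (hK0 : ∀ x y, 0 ≤ K x y) (hK1 : ∀ x, ∑ y, K x y = 1)
    (x x' : X)
    (hdisj : {y | 0 < K x y} ∩ {y | 0 < K x' y} = ∅) :
    sSup {r : ℝ |
      ∃ P Q : X → ℝ, (∀ z, 0 < P z) ∧ (∀ z, 0 < Q z) ∧
        (∑ z, P z) = 1 ∧ (∑ z, Q z) = 1 ∧ P ≠ Q ∧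
        r = ((α - 1)⁻¹ *
              Real.log (∑ y, (∑ z, K z y * P z) ^ α * (∑ z, K z y * Q z) ^ (1 - α))) /
            ((α - 1)⁻¹ * Real.log (∑ z, P z ^ α * Q z ^ (1 - α)))} = 1 := by
  classical
  have hα1 : 0 < α - 1 := by linarith
  have hsim : ∀ a b : ℝ, ((α - 1)⁻¹ * a) / ((α - 1)⁻¹ * b) = a / b := fun a b =>
    mul_div_mul_left a b (inv_ne_zero hα1.ne')
  simp only [hsim]
  have hone : ∀ P Q : X → ℝ, (∀ z, 0 < P z) → (∀ z, 0 < Q z) →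
      (∑ z, P z) = 1 → (∑ z, Q z) = 1 → 1 ≤ ∑ z, P z ^ α * Q z ^ (1 - α) := by
    intro P Q hP hQ h1 h2
    have := aux_jensen α hα (fun _ => 1) P Q (fun _ => zero_le_one) hP hQ
    simpa [h1, h2] using this
  -- a good output symbol
  obtain ⟨y0, hy0⟩ : ∃ y, 0 < K x y := by
    by_contra! h
    have : ∑ y, K x y ≤ 0 := Finset.sum_nonpos fun y _ => h y
    linarith [hK1 x]
  have hy0' : K x' y0 = 0 := by
    by_contra h
    have : y0 ∈ {y | 0 < K x y} ∩ {y | 0 < K x' y} :=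
      ⟨hy0, lt_of_le_of_ne (hK0 _ _) (Ne.symm h)⟩
    rw [hdisj] at this
    exact this
  have hne : x ≠ x' := by
    rintro rfl
    linarith
  have hKle : ∀ z y, K z y ≤ 1 := fun z y => by
    rw [← hK1 z]
    exact Finset.single_le_sum (f := fun y => K z y) (fun y _ => hK0 z y) (Finset.mem_univ y)
  set n : ℝ := (Fintype.card X : ℝ) with hn
  have hn1 : 1 ≤ n := by
    have : 0 < Fintype.card X := Fintype.card_pos_iff.2 ⟨x⟩
    rw [hn]; exact_mod_cast this
  have hn0 : 0 < n := by linarith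
  set c : ℝ := (K x y0 / n) ^ α * n ^ (1 - α) with hcdef
  have hc : 0 < c := by positivity
  have key : ∀ w < (1 : ℝ), ∃ P Q : X → ℝ, (∀ z, 0 < P z) ∧ (∀ z, 0 < Q z) ∧
        (∑ z, P z) = 1 ∧ (∑ z, Q z) = 1 ∧ P ≠ Q ∧ w <
          Real.log (∑ y, (∑ z, K z y * P z) ^ α * (∑ z, K z y * Q z) ^ (1 - α)) /
            Real.log (∑ z, P z ^ α * Q z ^ (1 - α)) := by
    intro w0 hw0
    obtain ⟨w, hw, hwn, hw1⟩ : ∃ w, w0 ≤ w ∧ 0 ≤ w ∧ w < 1 :=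
      ⟨max w0 0, le_max_left _ _, le_max_right _ _, max_lt hw0 one_pos⟩
    have h1w : 0 < (α - 1) * (1 - w) := mul_pos hα1 (by linarith)
    obtain ⟨L, hL⟩ := exists_gt (max (max 0 (Real.log n)) (-Real.log c / ((α - 1) * (1 - w))))
    obtain ⟨hL1, hL3⟩ := max_lt_iff.1 hL
    obtain ⟨hL1, hL2⟩ := max_lt_iff.1 hL1
    rw [div_lt_iff₀ h1w] at hL3
    set δ := Real.exp (-L) with hδ
    have hδ0 : 0 < δ := Real.exp_pos _
    have hnδ : n * δ < 1 := by
      have : n < Real.exp L := (Real.log_lt_iff_lt_exp hn0).1 hL2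
      calc n * δ < Real.exp L * δ := mul_lt_mul_of_pos_right this hδ0
        _ = 1 := by rw [hδ, ← Real.exp_add]; simp
    let P : X → ℝ := fun _ => 1 / n
    let Q : X → ℝ := fun z => δ + if z = x' then 1 - n * δ else 0
    have hP : ∀ z, 0 < P z := fun z => by simp only [P]; positivity
    have hQδ : ∀ z, δ ≤ Q z := fun z => by
      simp only [Q]; split_ifs <;> linarith
    have hQ : ∀ z, 0 < Q z := fun z => hδ0.trans_le (hQδ z)
    have hP1 : ∑ z, P z = 1 := by
      simp only [P, Finset.sum_const, Finset.card_univ, nsmul_eq_mul, ← hn]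
      field_simp
    have hQ1 : ∑ z, Q z = 1 := by
      simp only [Q, Finset.sum_add_distrib, Finset.sum_const, Finset.card_univ, nsmul_eq_mul, ← hn,
        Finset.sum_ite_eq', Finset.mem_univ, if_true]
      ring
    have hPQ : P ≠ Q := by
      intro h
      have := congrFun h x
      simp only [P, Q, hne, if_false, add_zero] at this
      rw [← this] at hnδ
      field_simp at hnδ
      exact lt_irrefl _ hnδ
    refine ⟨P, Q, hP, hQ, hP1, hQ1, hPQ, ?_⟩
    set N := ∑ y, (∑ z, K z y * P z) ^ α * (∑ z, K z y * Q z) ^ (1 - α) with hN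
    set D := ∑ z, P z ^ α * Q z ^ (1 - α) with hD
    have hND : N ≤ D := aux_dpi α hα K hK0 hK1 P Q hP hQ
    have hδp : 0 < δ ^ (1 - α) := Real.rpow_pos_of_pos hδ0 _
    have hlogδ : Real.log (δ ^ (1 - α)) = (α - 1) * L := by
      rw [Real.log_rpow hδ0, hδ, Real.log_exp]; ring
    have hDle : D ≤ δ ^ (1 - α) := by
      calc D ≤ ∑ z, P z * δ ^ (1 - α) := by
            refine Finset.sum_le_sum fun z _ => ?_
            refine mul_le_mul ?_ ?_ (Real.rpow_nonneg (hQ z).le _) (hP z).le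
            · refine Real.rpow_le_self_of_le_one (hP z).le ?_ hα.le
              simp only [P]
              rw [div_le_one hn0]; exact hn1
            · exact Real.rpow_le_rpow_of_nonpos hδ0 (hQδ z) (by linarith)
        _ = _ := by rw [← Finset.sum_mul, hP1, one_mul]
    have hNge : c * δ ^ (1 - α) ≤ N := by
      have hterm : (K x y0 / n) ^ α * (n * δ) ^ (1 - α) ≤
          (∑ z, K z y0 * P z) ^ α * (∑ z, K z y0 * Q z) ^ (1 - α) := by
        have hPy : K x y0 / n ≤ ∑ z, K z y0 * P z := by
          have := Finset.single_le_sum (f := fun z => K z y0 * P z)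
            (fun z _ => mul_nonneg (hK0 z y0) (hP z).le) (Finset.mem_univ x)
          simpa [P, div_eq_mul_inv] using this
        have hQy0 : 0 < ∑ z, K z y0 * Q z :=
          (mul_pos hy0 (hQ x)).trans_le (Finset.single_le_sum (f := fun z => K z y0 * Q z)
            (fun z _ => mul_nonneg (hK0 z y0) (hQ z).le) (Finset.mem_univ x))
        have hQy : ∑ z, K z y0 * Q z ≤ n * δ := by
          calc ∑ z, K z y0 * Q z ≤ ∑ _z : X, δ := by
                refine Finset.sum_le_sum fun z _ => ?_
                by_cases hz : z = x'
                · rw [hz, hy0', zero_mul]; exact hδ0.le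
                · simp only [Q, hz, if_false, add_zero]
                  exact mul_le_of_le_one_left hδ0.le (hKle z y0)
            _ = n * δ := by simp [hn]
        refine mul_le_mul ?_ ?_ (by positivity) (Real.rpow_nonneg ?_ _)
        · exact Real.rpow_le_rpow (by positivity) hPy (by linarith)
        · exact Real.rpow_le_rpow_of_nonpos hQy0 hQy (by linarith)
        · exact le_trans (by positivity) hPy
      rw [hcdef, mul_assoc, ← Real.mul_rpow hn0.le hδ0.le]
      exact hterm.trans (Finset.single_le_sum
        (f := fun y => (∑ z, K z y * P z) ^ α * (∑ z, K z y * Q z) ^ (1 - α))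
        (fun y _ => aux_nonneg α K hK0 P Q hP hQ y) (Finset.mem_univ y0))
    have hN0 : 0 < N := lt_of_lt_of_le (mul_pos hc hδp) hNge
    have hlN : Real.log c + (α - 1) * L ≤ Real.log N := by
      rw [← hlogδ, ← Real.log_mul hc.ne' hδp.ne']
      exact Real.log_le_log (mul_pos hc hδp) hNge
    have hlD : Real.log D ≤ (α - 1) * L := by
      rw [← hlogδ]
      exact Real.log_le_log (hN0.trans_le hND) hDle
    have hlND : Real.log N ≤ Real.log D := Real.log_le_log hN0 hND
    have hbig : w * ((α - 1) * L) < Real.log N := by nlinarith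
    have hpos : 0 ≤ w * ((α - 1) * L) := by positivity
    have hDpos : 0 < Real.log D := by linarith
    rw [lt_div_iff₀ hDpos]
    calc w0 * Real.log D ≤ w * Real.log D := mul_le_mul_of_nonneg_right hw hDpos.le
      _ ≤ w * ((α - 1) * L) := mul_le_mul_of_nonneg_left hlD hwn
      _ < _ := hbig
  apply csSup_eq_of_forall_le_of_forall_lt_exists_gt
  · obtain ⟨P, Q, h1, h2, h3, h4, h5, _⟩ := key 0 one_pos
    exact ⟨_, P, Q, h1, h2, h3, h4, h5, rfl⟩
  · rintro r ⟨P, Q, hP, hQ, hP1, hQ1, -, rfl⟩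
    have hD := hone P Q hP hQ hP1 hQ1
    have hlD := Real.log_nonneg hD
    refine div_le_one_of_le₀ ?_ hlD
    rcases (Finset.sum_nonneg fun y (_ : y ∈ Finset.univ) =>
      aux_nonneg α K hK0 P Q hP hQ y).eq_or_lt with h | h
    · rw [← h, Real.log_zero]; exact hlD
    · exact Real.log_le_log h (aux_dpi α hα K hK0 hK1 P Q hP hQ)
  · intro w hw
    obtain ⟨P, Q, h1, h2, h3, h4, h5, h6⟩ := key w hw
    exact ⟨_, ⟨P, Q, h1, h2, h3, h4, h5, rfl⟩, h6⟩
end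

section
/- Let α > 1, let N ≥ 3, let 𝒳 = {1,…,N}, let 𝒴 be a finite set, and let K be a channel from 𝒳 to 𝒴. Suppose i, j ∈ 𝒳 are distinct indices such that the supports of K(·|i) and K(·|j) are disjoint. For γ ∈ (0,1) define the distributions P^γ(x) = (1−γ) if x = i and γ/(N−1) otherwise, and Q^γ(x) = (1−γ)/2 if x ∈ {i, j} and γ/(N−2) otherwise. Then lim_{γ → 0⁺} D_α(K∘P^γ ‖ K∘Q^γ) / D_α(P^γ ‖ Q^γ) = 1. -/
open Real

theorem key_lim (α : ℝ) (hα : 1 < α)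
    (N : ℕ) (hN : 3 ≤ N) (k : Fin N → ℝ) (hk : ∀ x, 0 ≤ k x)
    (i j : Fin N) (hij : i ≠ j) (hd : k i = 0 ∨ k j = 0) :
    Filter.Tendsto (fun γ : ℝ =>
      (∑ x, k x * (if x = i then 1 - γ else γ / ((N : ℝ) - 1))) ^ α *
      (∑ x, k x * (if x = i ∨ x = j then (1 - γ) / 2 else γ / ((N : ℝ) - 2))) ^ (1 - α))
      (nhdsWithin 0 (Set.Ioi 0)) (nhds (k i * 2 ^ (α - 1))) := by
  have hN' : (3 : ℝ) ≤ N := by exact_mod_cast hN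
  by_cases h0 : k i = 0 ∧ k j = 0
  · obtain ⟨hi, hj⟩ := h0
    have hS : 0 ≤ ∑ x, k x := Finset.sum_nonneg fun x _ => hk x
    set S := ∑ x, k x with hSdef
    have e : (fun γ : ℝ => γ * ((S / ((N : ℝ) - 1)) ^ α * (S / ((N : ℝ) - 2)) ^ (1 - α)))
        =ᶠ[nhdsWithin 0 (Set.Ioi 0)] (fun γ : ℝ =>
      (∑ x, k x * (if x = i then 1 - γ else γ / ((N : ℝ) - 1))) ^ α *
      (∑ x, k x * (if x = i ∨ x = j then (1 - γ) / 2 else γ / ((N : ℝ) - 2))) ^ (1 - α)) := by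
      filter_upwards [self_mem_nhdsWithin] with γ hγ
      have hγ : 0 < γ := hγ
      have e1 : (∑ x, k x * (if x = i then 1 - γ else γ / ((N : ℝ) - 1)))
          = γ * (S / ((N : ℝ) - 1)) := by
        have : γ * (S / ((N : ℝ) - 1)) = S * (γ / ((N : ℝ) - 1)) := by ring
        rw [this, hSdef, Finset.sum_mul]
        refine Finset.sum_congr rfl fun x _ => ?_
        split_ifs with h
        · subst h; simp [hi]
        · rfl
      have e2 : (∑ x, k x * (if x = i ∨ x = j then (1 - γ) / 2 else γ / ((N : ℝ) - 2)))
          = γ * (S / ((N : ℝ) - 2)) := by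
        have : γ * (S / ((N : ℝ) - 2)) = S * (γ / ((N : ℝ) - 2)) := by ring
        rw [this, hSdef, Finset.sum_mul]
        refine Finset.sum_congr rfl fun x _ => ?_
        split_ifs with h
        · rcases h with h | h <;> subst h
          · simp [hi]
          · simp [hj]
        · rfl
      rw [e1, e2, mul_rpow hγ.le (div_nonneg hS (by linarith)),
        mul_rpow hγ.le (div_nonneg hS (by linarith))]
      have : γ ^ α * γ ^ (1 - α) = γ := by
        rw [← rpow_add hγ]; simp
      calc _ = (γ ^ α * γ ^ (1 - α)) *
            ((S / ((N : ℝ) - 1)) ^ α * (S / ((N : ℝ) - 2)) ^ (1 - α)) := by rw [this]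
        _ = _ := by ring
    refine Filter.Tendsto.congr' e ?_
    refine Filter.Tendsto.mono_left ?_ nhdsWithin_le_nhds
    have : Continuous (fun γ : ℝ =>
      γ * ((S / ((N : ℝ) - 1)) ^ α * (S / ((N : ℝ) - 2)) ^ (1 - α))) := by fun_prop
    have h := this.tendsto 0
    simpa [hi] using h
  · have hpos : 0 < k i + k j := by
      by_contra hc
      exact h0 ⟨by linarith [hk i, hk j], by linarith [hk i, hk j]⟩
    have c1 : Continuous (fun γ : ℝ =>
      ∑ x, k x * (if x = i then 1 - γ else γ / ((N : ℝ) - 1))) := by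
      refine continuous_finsetSum _ fun x _ => ?_
      split_ifs <;> fun_prop
    have c2 : Continuous (fun γ : ℝ =>
      ∑ x, k x * (if x = i ∨ x = j then (1 - γ) / 2 else γ / ((N : ℝ) - 2))) := by
      refine continuous_finsetSum _ fun x _ => ?_
      split_ifs <;> fun_prop
    have t1 := c1.tendsto 0
    have t2 := c2.tendsto 0
    have v1 : (∑ x, k x * (if x = i then 1 - (0:ℝ) else 0 / ((N : ℝ) - 1))) = k i := by
      simp
    have v2 : (∑ x, k x * (if x = i ∨ x = j then (1 - (0:ℝ)) / 2 else 0 / ((N : ℝ) - 2)))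
        = (k i + k j) / 2 := by
      have : ∀ x, k x * (if x = i ∨ x = j then (1 - (0:ℝ)) / 2 else 0 / ((N : ℝ) - 2))
          = (if x = i then k x / 2 else 0) + (if x = j then k x / 2 else 0) := by
        intro x
        by_cases h1 : x = i
        · subst h1; simp [hij]; ring
        · by_cases h2 : x = j
          · simp [h1, h2, hij.symm]; ring
          · simp [h1, h2]
      rw [Finset.sum_congr rfl fun x _ => this x, Finset.sum_add_distrib]
      simp; ring
    simp only [v1] at t1
    simp only [v2] at t2
    have t := (t1.rpow_const (p := α) (Or.inr (by linarith))).mul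
      (t2.rpow_const (p := 1 - α) (Or.inl (by positivity)))
    refine Filter.Tendsto.mono_left ?_ nhdsWithin_le_nhds
    convert t using 2
    rcases hd with h | h
    · rw [h, zero_rpow (by linarith)]; simp
    · have hi : 0 < k i := by linarith
      rw [h, add_zero, div_rpow hi.le (by norm_num), ← mul_div_assoc, ← rpow_add hi,
        div_eq_mul_inv, ← rpow_neg (by norm_num)]
      simp

/-- For a channel `K` on `Fin N` (`N ≥ 3`) with two inputs `i ≠ j` having
disjoint output supports, the ratio of Rényi divergences of order `α > 1` for the perturbed
point masses `P^γ` and `Q^γ` tends to `1` as `γ → 0⁺`. -/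
theorem stmt_1 {Y : Type*} [Fintype Y] (α : ℝ) (hα : 1 < α)
    (N : ℕ) (hN : 3 ≤ N)
    (K : Fin N → Y → ℝ) (hK0 : ∀ x y, 0 ≤ K x y) (hK1 : ∀ x, ∑ y, K x y = 1)
    (i j : Fin N) (hij : i ≠ j)
    (hdisj : {y | 0 < K i y} ∩ {y | 0 < K j y} = ∅) :
    Filter.Tendsto (fun γ : ℝ =>
      (fun (P Q : Fin N → ℝ) =>
          ((α - 1)⁻¹ *
              Real.log (∑ y, (∑ x, K x y * P x) ^ α * (∑ x, K x y * Q x) ^ (1 - α))) /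
            ((α - 1)⁻¹ * Real.log (∑ x, P x ^ α * Q x ^ (1 - α))))
        (fun x => if x = i then 1 - γ else γ / ((N : ℝ) - 1))
        (fun x => if x = i ∨ x = j then (1 - γ) / 2 else γ / ((N : ℝ) - 2)))
      (nhdsWithin 0 (Set.Ioi 0)) (nhds 1) := by
  have num := tendsto_finsetSum Finset.univ fun y (_ : y ∈ (Finset.univ : Finset Y)) =>
    key_lim α hα N hN (fun x => K x y) (fun x => hK0 x y) i j hij (by
      by_contra hc
      push Not at hc
      have : y ∈ {y | 0 < K i y} ∩ {y | 0 < K j y} :=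
        ⟨lt_of_le_of_ne (hK0 _ _) (Ne.symm hc.1), lt_of_le_of_ne (hK0 _ _) (Ne.symm hc.2)⟩
      rw [hdisj] at this
      exact this)
  have den := tendsto_finsetSum Finset.univ fun y (_ : y ∈ (Finset.univ : Finset (Fin N))) =>
    key_lim α hα N hN (fun x => if x = y then 1 else 0)
      (fun x => by split_ifs <;> norm_num) i j hij (by
      by_cases h : i = y
      · right; subst h; simp [hij.symm]
      · left; simp [h])
  rw [← Finset.sum_mul, hK1, one_mul] at num
  rw [← Finset.sum_mul] at den
  simp only [ite_mul, one_mul, zero_mul, Finset.sum_ite_eq, Finset.sum_ite_eq',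
    Finset.mem_univ, if_true] at den
  have h1 : (1:ℝ) < 2 ^ (α - 1) := one_lt_rpow (by norm_num) (by linarith)
  have hl : 0 < Real.log ((2:ℝ) ^ (α - 1)) := Real.log_pos h1
  have ha : 0 < (α - 1)⁻¹ := inv_pos.mpr (by linarith)
  have h2 : (2:ℝ) ^ (α - 1) ≠ 0 := by positivity
  have fin := ((num.log h2).const_mul (α - 1)⁻¹).div ((den.log h2).const_mul (α - 1)⁻¹)
    (mul_pos ha hl).ne'
  rw [div_self (mul_pos ha hl).ne'] at fin
  exact fin
end

section
/- Let α > 1 and let P, Q be probability distributions on a finite set 𝒳 with P(x) > 0 and Q(x) > 0 for all x and P ≠ Q. Set u = max_x P(x)/Q(x) and v = min_x P(x)/Q(x) (so v < 1 < u). Then D_{f_α}(P ‖ Q) ≤ TV(P ‖ Q) · R_α(u, v), where R_α(u, v) = (u^α − 1)/(u − 1) − (1 − v^α)/(1 − v). -/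
open Real

/-- Reverse Pinsker for `f_α`-divergence: for strictly positive distributions
`P ≠ Q` on a finite set, with `u = max_x P(x)/Q(x)` and `v = min_x P(x)/Q(x)`,
`D_{f_α}(P‖Q) ≤ TV(P‖Q) · R_α(u,v)` where
`R_α(u,v) = (u^α − 1)/(u − 1) − (1 − v^α)/(1 − v)`. -/
theorem stmt_2 {X : Type*} [Fintype X] (α : ℝ) (hα : 1 < α)
    (P Q : X → ℝ) (hP0 : ∀ x, 0 < P x) (hQ0 : ∀ x, 0 < Q x)
    (hP1 : ∑ x, P x = 1) (hQ1 : ∑ x, Q x = 1) (hPQ : P ≠ Q)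
    (u v : ℝ)
    (hu : ∀ x, P x / Q x ≤ u) (hu' : ∃ x, P x / Q x = u)
    (hv : ∀ x, v ≤ P x / Q x) (hv' : ∃ x, P x / Q x = v) :
    (∑ x, Q x * (P x / Q x) ^ α) - 1 ≤
      ((1 / 2) * ∑ x, |P x - Q x|) *
        ((u ^ α - 1) / (u - 1) - (1 - v ^ α) / (1 - v)) := by
  obtain ⟨x0, hx0⟩ := hv'
  have hv0 : 0 < v := by rw [← hx0]; exact div_pos (hP0 x0) (hQ0 x0)
  have hc := convexOn_rpow hα.le
  set A := (u ^ α - 1) / (u - 1) with hA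
  set B := (1 - v ^ α) / (1 - v) with hB
  have hB' : B = (v ^ α - 1) / (v - 1) := by
    rw [hB, ← neg_sub (v ^ α) 1, ← neg_sub v 1, neg_div_neg_eq]
  have key : ∀ t : ℝ, v ≤ t → t ≤ u →
      t ^ α - 1 ≤ (A - B) / 2 * |t - 1| + (A + B) / 2 * (t - 1) := by
    intro t h1 h2
    have ht0 : 0 < t := hv0.trans_le h1
    rcases lt_trichotomy t 1 with h | h | h
    · have hs := hc.secant_mono (a := 1) (x := v) (y := t) (by simp) hv0.le ht0.le
        (h1.trans_lt h).ne h.ne h1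
      simp only [one_rpow] at hs
      rw [← hB', le_div_iff_of_neg (by linarith)] at hs
      rw [abs_of_neg (by linarith)]
      linarith
    · subst h
      simp
    · have hs := hc.secant_mono (a := 1) (x := t) (y := u) (by simp) ht0.le
        (ht0.le.trans h2) h.ne' (h.trans_le h2).ne' h2
      simp only [one_rpow] at hs
      rw [← hA, div_le_iff₀ (by linarith)] at hs
      rw [abs_of_pos (by linarith)]
      linarith
  have hpt : ∀ x, Q x * (P x / Q x) ^ α ≤
      Q x + ((A - B) / 2 * |P x - Q x| + (A + B) / 2 * (P x - Q x)) := by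
    intro x
    have h := mul_le_mul_of_nonneg_left (key _ (hv x) (hu x)) (hQ0 x).le
    have e1 : Q x * (P x / Q x - 1) = P x - Q x := by
      have := (hQ0 x).ne'
      field_simp
    have e2 : Q x * |P x / Q x - 1| = |P x - Q x| := by
      rw [← e1, abs_mul, abs_of_pos (hQ0 x)]
    rw [← e2, ← e1]
    linarith
  have hsum := Finset.sum_le_sum (fun x (_ : x ∈ Finset.univ) => hpt x)
  simp only [Finset.sum_add_distrib, ← Finset.mul_sum, Finset.sum_sub_distrib, hP1, hQ1] at hsum
  linarith
end

section
/- Let P, Q be strictly positive probability distributions on a finite set 𝒳 with P ≠ Q, and set Δ = TV(P ‖ Q), v = min_x P(x)/Q(x), and u = max_x P(x)/Q(x) (so v < 1 < u). Then for every γ ∈ [v, 1] one has E_γ(P ‖ Q) ≤ Δ (γ − v)/(1 − v), and for every γ ∈ [1, u] one has E_γ(P ‖ Q) ≤ Δ (u − γ)/(u − 1). -/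
open Real

/-- Piecewise-linear upper bound on the hockeystick divergence `E_γ(P‖Q)` in
terms of `Δ = TV(P‖Q)`, `v = min_x P(x)/Q(x)` and `u = max_x P(x)/Q(x)`:
`E_γ ≤ Δ (γ − v)/(1 − v)` on `[v, 1]` and `E_γ ≤ Δ (u − γ)/(u − 1)` on `[1, u]`. -/
theorem stmt_4 {X : Type*} [Fintype X]
    (P Q : X → ℝ) (hP0 : ∀ x, 0 < P x) (hQ0 : ∀ x, 0 < Q x)
    (hP1 : ∑ x, P x = 1) (hQ1 : ∑ x, Q x = 1) (hPQ : P ≠ Q)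
    (Δ u v : ℝ) (hΔ : Δ = (1 / 2) * ∑ x, |P x - Q x|)
    (hu : ∀ x, P x / Q x ≤ u) (hu' : ∃ x, P x / Q x = u)
    (hv : ∀ x, v ≤ P x / Q x) (hv' : ∃ x, P x / Q x = v) :
    (∀ γ ∈ Set.Icc v 1,
        (1 / 2) * (∑ x, |P x - γ * Q x|) - (1 / 2) * |1 - γ| ≤ Δ * (γ - v) / (1 - v)) ∧
    (∀ γ ∈ Set.Icc 1 u,
        (1 / 2) * (∑ x, |P x - γ * Q x|) - (1 / 2) * |1 - γ| ≤ Δ * (u - γ) / (u - 1)) := by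
  have hv2 : ∀ x, v * Q x ≤ P x := fun x => (le_div_iff₀ (hQ0 x)).1 (hv x)
  have hu2 : ∀ x, P x ≤ u * Q x := fun x => (div_le_iff₀ (hQ0 x)).1 (hu x)
  have hv1 : v < 1 := by
    by_contra! h
    apply hPQ
    have h1 : ∀ x ∈ Finset.univ, Q x ≤ P x := fun x _ => by nlinarith [hv2 x, hQ0 x]
    have h2 := (Finset.sum_eq_sum_iff_of_le h1).1 (hQ1.trans hP1.symm)
    funext x
    exact (h2 x (Finset.mem_univ x)).symm
  have hu1 : 1 < u := by
    by_contra! h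
    apply hPQ
    have h1 : ∀ x ∈ Finset.univ, P x ≤ Q x := fun x _ => by nlinarith [hu2 x, hQ0 x]
    have h2 := (Finset.sum_eq_sum_iff_of_le h1).1 (hP1.trans hQ1.symm)
    funext x
    exact h2 x (Finset.mem_univ x)
  constructor
  · rintro γ ⟨h1, h2⟩
    have key : ∑ x, (1 - v) * |P x - γ * Q x|
        ≤ ∑ x, ((γ - v) * |P x - Q x| + (1 - γ) * (P x - v * Q x)) := by
      apply Finset.sum_le_sum
      intro x _
      have e : (1 - v) * (P x - γ * Q x)
          = (γ - v) * (P x - Q x) + (1 - γ) * (P x - v * Q x) := by ring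
      have := abs_add_le ((γ - v) * (P x - Q x)) ((1 - γ) * (P x - v * Q x))
      rw [← e, abs_mul, abs_mul, abs_mul, abs_of_nonneg (sub_nonneg.2 hv1.le),
        abs_of_nonneg (sub_nonneg.2 h1), abs_of_nonneg (sub_nonneg.2 h2),
        abs_of_nonneg (sub_nonneg.2 (hv2 x))] at this
      exact this
    rw [Finset.sum_add_distrib, ← Finset.mul_sum, ← Finset.mul_sum, ← Finset.mul_sum,
      Finset.sum_sub_distrib, ← Finset.mul_sum, hP1, hQ1] at key
    rw [le_div_iff₀ (sub_pos.2 hv1), abs_of_nonneg (sub_nonneg.2 h2), hΔ]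
    linarith
  · rintro γ ⟨h1, h2⟩
    have key : ∑ x, (u - 1) * |P x - γ * Q x|
        ≤ ∑ x, ((u - γ) * |P x - Q x| + (γ - 1) * (u * Q x - P x)) := by
      apply Finset.sum_le_sum
      intro x _
      have e : (u - 1) * (P x - γ * Q x)
          = (u - γ) * (P x - Q x) - (γ - 1) * (u * Q x - P x) := by ring
      have := abs_sub ((u - γ) * (P x - Q x)) ((γ - 1) * (u * Q x - P x))
      rw [← e, abs_mul, abs_mul, abs_mul, abs_of_nonneg (sub_nonneg.2 hu1.le),
        abs_of_nonneg (sub_nonneg.2 h1), abs_of_nonneg (sub_nonneg.2 h2),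
        abs_of_nonneg (sub_nonneg.2 (hu2 x))] at this
      exact this
    rw [Finset.sum_add_distrib, ← Finset.mul_sum, ← Finset.mul_sum, ← Finset.mul_sum,
      Finset.sum_sub_distrib, ← Finset.mul_sum, hP1, hQ1] at key
    rw [le_div_iff₀ (sub_pos.2 hu1), abs_of_nonpos (sub_nonpos.2 h1), hΔ]
    linarith
end

section
/- Let α > 1 and let P, Q be probability distributions on a finite set 𝒳 such that P(x) > 0 if and only if Q(x) > 0 for all x. Then D_{f_α}(P ‖ Q) = α(α−1) ∫_0^∞ E_γ(P ‖ Q) γ^{α−2} dγ. -/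
open Real MeasureTheory

lemma aux_int (α : ℝ) (hα : 1 < α) (t : ℝ) (ht : 0 ≤ t) :
    IntegrableOn (fun γ : ℝ => max (t - γ) 0 * γ ^ (α - 2)) (Set.Ioi 0) ∧
    ∫ γ in Set.Ioi (0:ℝ), max (t - γ) 0 * γ ^ (α - 2) = t ^ α / (α * (α - 1)) := by
  have hU : Set.Ioi (0:ℝ) = Set.Ioc 0 t ∪ Set.Ioi t := (Set.Ioc_union_Ioi_eq_Ioi ht).symm
  have e1 : Set.EqOn (fun γ : ℝ => max (t - γ) 0 * γ ^ (α - 2))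
      (fun γ => t * γ ^ (α - 2) - γ ^ (α - 1)) (Set.Ioc 0 t) := by
    intro γ hγ
    have h : γ ^ (α - 1) = γ * γ ^ (α - 2) := by
      rw [show α - 1 = 1 + (α - 2) by ring, rpow_add hγ.1, rpow_one]
    simp only [h]
    rw [max_eq_left (by linarith [hγ.2])]
    ring
  have e2 : Set.EqOn (fun γ : ℝ => max (t - γ) 0 * γ ^ (α - 2))
      (fun _ => 0) (Set.Ioi t) := by
    intro γ hγ
    have : t < γ := hγ
    simp only
    rw [max_eq_right (by linarith)]
    ring
  have i1 : IntervalIntegrable (fun γ : ℝ => t * γ ^ (α - 2)) volume 0 t :=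
    (intervalIntegral.intervalIntegrable_rpow' (by linarith)).const_mul t
  have i2 : IntervalIntegrable (fun γ : ℝ => γ ^ (α - 1)) volume 0 t :=
    intervalIntegral.intervalIntegrable_rpow' (by linarith)
  have I1 : IntegrableOn (fun γ : ℝ => max (t - γ) 0 * γ ^ (α - 2)) (Set.Ioc 0 t) := by
    rw [integrableOn_congr_fun e1 measurableSet_Ioc]
    exact (intervalIntegrable_iff_integrableOn_Ioc_of_le ht).1 (i1.sub i2)
  have I2 : IntegrableOn (fun γ : ℝ => max (t - γ) 0 * γ ^ (α - 2)) (Set.Ioi t) := by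
    rw [integrableOn_congr_fun e2 measurableSet_Ioi]
    exact integrableOn_zero
  refine ⟨by rw [hU]; exact I1.union I2, ?_⟩
  rw [hU, setIntegral_union (Set.Ioc_disjoint_Ioi le_rfl) measurableSet_Ioi I1 I2,
    setIntegral_congr_fun measurableSet_Ioc e1, setIntegral_congr_fun measurableSet_Ioi e2,
    ← intervalIntegral.integral_of_le ht, intervalIntegral.integral_sub i1 i2,
    intervalIntegral.integral_const_mul, integral_rpow (Or.inl (by linarith)),
    integral_rpow (Or.inl (by linarith))]
  have h1 : α - 1 ≠ 0 := by linarith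
  have h0 : α ≠ 0 := by linarith
  rw [show α - 2 + 1 = α - 1 by ring, show α - 1 + 1 = α by ring, zero_rpow h1, zero_rpow h0]
  have h : t ^ α = t * t ^ (α - 1) := by
    rcases ht.eq_or_lt with rfl | h
    · simp [zero_rpow h0]
    · rw [show α = 1 + (α - 1) by ring, rpow_add h, rpow_one]; ring_nf
  simp only [integral_zero, h]
  field_simp
  ring

/-- Integral representation of the `f_α`-divergence via the hockeystick
divergence: `D_{f_α}(P‖Q) = α(α−1) ∫_0^∞ E_γ(P‖Q) γ^{α−2} dγ`. -/
theorem stmt_6 {X : Type*} [Fintype X] (α : ℝ) (hα : 1 < α)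
    (P Q : X → ℝ) (hP0 : ∀ x, 0 ≤ P x) (hQ0 : ∀ x, 0 ≤ Q x)
    (hP1 : ∑ x, P x = 1) (hQ1 : ∑ x, Q x = 1)
    (hsupp : ∀ x, 0 < P x ↔ 0 < Q x) :
    (∑ x ∈ Finset.univ.filter (fun x => 0 < Q x), Q x * (P x / Q x) ^ α) - 1 =
      α * (α - 1) *
        ∫ γ in Set.Ioi (0:ℝ),
          ((1 / 2) * (∑ x, |P x - γ * Q x|) - (1 / 2) * |1 - γ|) * γ ^ (α - 2) := by
  have habs : ∀ y : ℝ, |y| = 2 * max y 0 - y := by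
    intro y
    rcases le_total 0 y with h | h
    · rw [abs_of_nonneg h, max_eq_left h]; ring
    · rw [abs_of_nonpos h, max_eq_right h]; ring
  have hx : ∀ x γ, max (P x - γ * Q x) 0 = Q x * max (P x / Q x - γ) 0 := by
    intro x γ
    rcases (hQ0 x).eq_or_lt with h | h
    · have : P x = 0 := by
        by_contra hne
        have := (hsupp x).1 (lt_of_le_of_ne (hP0 x) (Ne.symm hne))
        linarith
      simp [this, ← h]
    · rw [mul_max_of_nonneg _ _ h.le, mul_zero]
      congr 1
      field_simp
  have key : ∀ γ : ℝ, ((1 / 2) * (∑ x, |P x - γ * Q x|) - (1 / 2) * |1 - γ|) * γ ^ (α - 2)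
      = (∑ x, Q x * (max (P x / Q x - γ) 0 * γ ^ (α - 2))) - max (1 - γ) 0 * γ ^ (α - 2) := by
    intro γ
    simp only [habs, hx, ← mul_assoc]
    rw [Finset.sum_sub_distrib, Finset.sum_sub_distrib, ← Finset.mul_sum, hP1,
      ← Finset.sum_mul, hQ1]
    simp only [mul_assoc (2:ℝ), ← Finset.mul_sum]
    ring
  have hd : ∀ x, 0 ≤ P x / Q x := fun x => div_nonneg (hP0 x) (hQ0 x)
  have hI : ∀ x, IntegrableOn (fun γ : ℝ => Q x * (max (P x / Q x - γ) 0 * γ ^ (α - 2)))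
      (Set.Ioi 0) := fun x => (aux_int α hα _ (hd x)).1.const_mul _
  simp only [key]
  rw [integral_sub (integrable_finsetSum _ fun x _ => hI x) (aux_int α hα 1 zero_le_one).1,
    integral_finsetSum _ fun x _ => hI x, (aux_int α hα 1 zero_le_one).2]
  simp only [integral_const_mul, (aux_int α hα _ (hd _)).2]
  have h1 : α - 1 ≠ 0 := by linarith
  have h0 : α ≠ 0 := by linarith
  rw [mul_sub, Finset.mul_sum, one_rpow, Finset.sum_filter]
  congr 1
  · refine Finset.sum_congr rfl fun x _ => ?_
    split_ifs with h
    · generalize (P x / Q x) ^ α = z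
      field_simp
    · rw [le_antisymm (not_lt.1 h) (hQ0 x)]; simp
  · field_simp
end

section
/- Let u > 1, v ∈ [0, 1), and Δ ∈ (0, 1]. Define R_α(u, v) = (u^α − 1)/(u − 1) − (1 − v^α)/(1 − v) for α > 1. Then lim_{α → ∞} (1/(α−1)) · log( Δ · R_α(u, v) + 1 ) = log u. -/
open Real

/-- Asymptotic tightness of the reverse Pinsker bound:
for `u > 1`, `v ∈ [0,1)` and `Δ ∈ (0,1]`,
`lim_{α → ∞} (1/(α−1)) log(Δ R_α(u,v) + 1) = log u`, where
`R_α(u,v) = (u^α − 1)/(u − 1) − (1 − v^α)/(1 − v)`. -/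
theorem stmt_7 (u v Δ : ℝ) (hu : 1 < u) (hv0 : 0 ≤ v) (hv1 : v < 1)
    (hΔ0 : 0 < Δ) (hΔ1 : Δ ≤ 1) :
    Filter.Tendsto
      (fun α : ℝ => (α - 1)⁻¹ *
        Real.log (Δ * ((u ^ α - 1) / (u - 1) - (1 - v ^ α) / (1 - v)) + 1))
      Filter.atTop (nhds (Real.log u)) := by
  have hV : Filter.Tendsto (fun α : ℝ => v ^ α) Filter.atTop (nhds 0) :=
    tendsto_rpow_atTop_of_base_lt_one v (by linarith) hv1
  have hU : Filter.Tendsto (fun α : ℝ => (u ^ α)⁻¹) Filter.atTop (nhds 0) := by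
    have h := tendsto_rpow_atTop_of_base_lt_one u⁻¹
      (by have : 0 < u⁻¹ := by positivity
          linarith) (inv_lt_one_of_one_lt₀ hu)
    refine h.congr (fun α => ?_)
    exact Real.inv_rpow (by linarith) α
  have hI : Filter.Tendsto (fun α : ℝ => (α - 1)⁻¹) Filter.atTop (nhds 0) :=
    tendsto_inv_atTop_zero.comp (Filter.tendsto_atTop_add_const_right _ (-1) Filter.tendsto_id)
  have hu1 : 0 < u - 1 := by linarith
  have hg : Filter.Tendsto (fun α : ℝ => Δ * ((1 - (u ^ α)⁻¹) / (u - 1)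
      - (1 - v ^ α) / (1 - v) * (u ^ α)⁻¹) + (u ^ α)⁻¹) Filter.atTop (nhds (Δ / (u - 1))) := by
    have h := (((((hU.const_sub 1).div_const (u - 1)).sub
      (((hV.const_sub 1).div_const (1 - v)).mul hU)).const_mul Δ).add hU)
    convert h using 2
    ring
  have hc : 0 < Δ / (u - 1) := div_pos hΔ0 hu1
  have hl := hI.mul (hg.log hc.ne')
  have hf := hl.add ((hI.const_add 1).mul_const (Real.log u))
  simp only [zero_mul, add_zero, one_mul, zero_add] at hf
  refine hf.congr' ?_
  filter_upwards [hg.eventually (lt_mem_nhds hc), Filter.eventually_gt_atTop 1] with α h1 h2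
  have hp : 0 < u ^ α := Real.rpow_pos_of_pos (by linarith) α
  have e : Δ * ((u ^ α - 1) / (u - 1) - (1 - v ^ α) / (1 - v)) + 1
      = (Δ * ((1 - (u ^ α)⁻¹) / (u - 1)
      - (1 - v ^ α) / (1 - v) * (u ^ α)⁻¹) + (u ^ α)⁻¹) * u ^ α := by
    have hv : 1 - v ≠ 0 := by linarith
    field_simp
  rw [e, Real.log_mul h1.ne' hp.ne', Real.log_rpow (by linarith)]
  have h3 : α - 1 ≠ 0 := by linarith
  have h4 : 1 + (α - 1)⁻¹ = (α - 1)⁻¹ * α := by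
    field_simp
    ring
  rw [h4]
  ring
end

section
/- Let α > 1 and let P, Q be probability distributions on a finite set 𝒳 such that P(x) > 0 if and only if Q(x) > 0 for all x. Let t = TV(P ‖ Q). Then D_{f_α}(P ‖ Q) ≥ g_α(t), where g_α(t) = e^{2(α−1)t²} − 1 if t < 1/α and α < 2; g_α(t) = (4t² + 1)^{α−1} − 1 if t < 1/α and α ≥ 2; and g_α(t) = (1−t)^{1−α} − 1 if t ≥ 1/α. -/
open Real

lemma aux_log (r : ℝ) (hr : 0 < r) : (r-1)*(5*r+1)/(2*r*(r+2)) ≤ Real.log r := by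
  set F : ℝ → ℝ := fun r => Real.log r - (r-1)*(5*r+1)/(2*r*(r+2)) with hF
  have hd : ∀ x : ℝ, 0 < x → HasDerivAt F ((x-1)^3/(x^2*(x+2)^2)) x := by
    intro x hx
    have h1 := Real.hasDerivAt_log hx.ne'
    have hid := hasDerivAt_id' x
    have h2 := ((hid.sub_const 1).mul ((hid.const_mul 5).add_const 1)).div
      ((hid.const_mul 2).mul (hid.add_const 2)) (by simp only [Pi.mul_apply]; positivity)
    have h3 := h1.sub h2
    refine h3.congr_deriv ?_
    simp only [Pi.mul_apply]
    field_simp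
    ring
  have hF1 : F 1 = 0 := by simp [hF]
  suffices h : 0 ≤ F r by simp only [hF] at h; linarith
  rcases le_total 1 r with h | h
  · have hm : MonotoneOn F (Set.Ici 1) := by
      apply monotoneOn_of_deriv_nonneg (convex_Ici 1)
      · intro x hx
        exact (hd x (lt_of_lt_of_le one_pos hx)).continuousAt.continuousWithinAt
      · intro x hx
        rw [interior_Ici] at hx
        exact (hd x (lt_trans one_pos hx)).differentiableAt.differentiableWithinAt
      · intro x hx
        rw [interior_Ici] at hx
        have hx' : (1:ℝ) < x := hx
        rw [(hd x (lt_trans one_pos hx)).deriv]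
        have : 0 ≤ x - 1 := by linarith
        positivity
    have := hm (Set.mem_Ici.2 le_rfl) (Set.mem_Ici.2 h) h
    linarith
  · have hm : AntitoneOn F (Set.Ioc 0 1) := by
      apply antitoneOn_of_deriv_nonpos (convex_Ioc 0 1)
      · intro x hx
        exact (hd x hx.1).continuousAt.continuousWithinAt
      · intro x hx
        rw [interior_Ioc] at hx
        exact (hd x hx.1).differentiableAt.differentiableWithinAt
      · intro x hx
        rw [interior_Ioc] at hx
        rw [(hd x hx.1).deriv]
        have h0 : 0 ≤ 1 - x := by linarith [hx.2]
        have : (x-1)^3/(x^2*(x+2)^2) = -((1-x)^3/(x^2*(x+2)^2)) := by ring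
        rw [this]
        have : 0 ≤ (1-x)^3/(x^2*(x+2)^2) := by positivity
        linarith
    have := hm (Set.mem_Ioc.2 ⟨hr, h⟩) (Set.mem_Ioc.2 ⟨one_pos, le_rfl⟩) h
    linarith

lemma aux_pinsker {X : Type*} (s : Finset X) (P Q : X → ℝ) (hP : ∀ x ∈ s, 0 < P x)
    (hQ : ∀ x ∈ s, 0 < Q x) (hP1 : ∑ x ∈ s, P x = 1) (hQ1 : ∑ x ∈ s, Q x = 1) :
    (∑ x ∈ s, |P x - Q x|)^2 ≤ 2 * ∑ x ∈ s, P x * Real.log (P x / Q x) := by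
  have h := Finset.sum_sq_le_sum_mul_sum_of_sq_eq_mul s (r := fun x => |P x - Q x|)
    (f := fun x => (2 * P x + 4 * Q x)/3) (g := fun x => 3 * (P x - Q x)^2 / (2 * P x + 4 * Q x))
    (fun x hx => by have := hP x hx; have := hQ x hx; positivity)
    (fun x hx => by have := hP x hx; have := hQ x hx; positivity)
    (fun x hx => by
      have := hP x hx; have := hQ x hx
      rw [sq_abs]; field_simp)
  have e1 : ∑ x ∈ s, (2 * P x + 4 * Q x)/3 = 2 := by
    rw [← Finset.sum_div, Finset.sum_add_distrib, ← Finset.mul_sum, ← Finset.mul_sum, hP1, hQ1]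
    norm_num
  have e2 : ∑ x ∈ s, 3 * (P x - Q x)^2 / (2 * P x + 4 * Q x)
      ≤ ∑ x ∈ s, (P x * Real.log (P x / Q x) - P x + Q x) := by
    apply Finset.sum_le_sum
    intro x hx
    have p := hP x hx
    have q := hQ x hx
    have := mul_le_mul_of_nonneg_left (aux_log (P x / Q x) (div_pos p q)) p.le
    refine le_trans (le_of_eq ?_) (add_le_add_left (sub_le_sub_right this (P x)) (Q x))
    field_simp
    ring
  rw [Finset.sum_add_distrib, Finset.sum_sub_distrib, hP1, hQ1] at e2
  rw [e1] at h
  linarith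

lemma aux_chi {X : Type*} (s : Finset X) (P Q : X → ℝ)
    (hQ : ∀ x ∈ s, 0 < Q x) (hP1 : ∑ x ∈ s, P x = 1) (hQ1 : ∑ x ∈ s, Q x = 1) :
    (∑ x ∈ s, |P x - Q x|)^2 + 1 ≤ ∑ x ∈ s, P x * (P x / Q x) := by
  have h := Finset.sum_sq_le_sum_mul_sum_of_sq_eq_mul s (r := fun x => |P x - Q x|)
    (f := Q) (g := fun x => (P x - Q x)^2 / Q x)
    (fun x hx => (hQ x hx).le)
    (fun x hx => by have := hQ x hx; positivity)
    (fun x hx => by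
      have := hQ x hx
      rw [sq_abs]; field_simp)
  have e2 : ∑ x ∈ s, (P x - Q x)^2 / Q x
      = ∑ x ∈ s, (P x * (P x / Q x) - 2 * P x + Q x) := by
    apply Finset.sum_congr rfl
    intro x hx
    have q := hQ x hx
    field_simp
    ring
  rw [Finset.sum_add_distrib, Finset.sum_sub_distrib, ← Finset.mul_sum, hP1, hQ1] at e2
  rw [e2, hQ1] at h
  linarith

lemma aux_tangent (α r s : ℝ) (hα : 1 < α) (hr : 0 < r) (hs : 0 < s) :
    s^(α-1) * (α * r + (1-α) * s) ≤ r^α := by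
  have h := one_add_mul_self_le_rpow_one_add (s := r/s - 1)
    (by have := div_pos hr hs; linarith) hα.le
  rw [add_sub_cancel, Real.div_rpow hr.le hs.le, le_div_iff₀ (by positivity)] at h
  refine le_trans (le_of_eq ?_) h
  have : s^α = s^(α-1) * s := by
    rw [Real.rpow_sub_one hs.ne']; field_simp
  rw [this]
  field_simp
  ring

lemma aux_main {X : Type*} (s : Finset X) (α : ℝ) (hα : 1 < α) (P Q : X → ℝ)
    (hP : ∀ x ∈ s, 0 < P x)
    (hQ : ∀ x ∈ s, 0 < Q x) (hP1 : ∑ x ∈ s, P x = 1) (hQ1 : ∑ x ∈ s, Q x = 1)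
    (t : ℝ) (ht : t = (1 / 2) * ∑ x ∈ s, |P x - Q x|) :
    (if t < 1 / α then
        (if α < 2 then Real.exp (2 * (α - 1) * t ^ 2) - 1
          else (4 * t ^ 2 + 1) ^ (α - 1) - 1)
      else (1 - t) ^ (1 - α) - 1) ≤
      (∑ x ∈ s, Q x * (P x / Q x) ^ α) - 1 := by
  have ht2 : ∑ x ∈ s, |P x - Q x| = 2 * t := by linarith
  have hrw : ∑ x ∈ s, Q x * (P x / Q x) ^ α = ∑ x ∈ s, P x * (P x / Q x)^(α-1) := by
    apply Finset.sum_congr rfl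
    intro x hx
    have p := hP x hx
    have q := hQ x hx
    rw [Real.rpow_sub_one (div_pos p q).ne']
    field_simp
  split_ifs with h1 h2
  · apply sub_le_sub_right
    rw [hrw]
    have hp := aux_pinsker s P Q hP hQ hP1 hQ1
    rw [ht2] at hp
    set c := 2 * (α - 1) * t ^ 2 with hc
    have key : ∑ x ∈ s, Real.exp c * (P x + (α-1) * (P x * Real.log (P x / Q x)) - P x * c)
        ≤ ∑ x ∈ s, P x * (P x / Q x)^(α-1) := by
      apply Finset.sum_le_sum
      intro x hx
      have p := hP x hx
      have q := hQ x hx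
      rw [Real.rpow_def_of_pos (div_pos p q)]
      have := Real.add_one_le_exp (Real.log (P x / Q x) * (α-1) - c)
      have h4 : Real.exp (Real.log (P x / Q x) * (α-1))
        = Real.exp c * Real.exp (Real.log (P x / Q x) * (α-1) - c) := by
        rw [← Real.exp_add]; congr 1; ring
      rw [h4]
      have := mul_le_mul_of_nonneg_left this (mul_pos p (Real.exp_pos c)).le
      linarith
    rw [← Finset.mul_sum, Finset.sum_sub_distrib, Finset.sum_add_distrib, ← Finset.mul_sum,
      ← Finset.sum_mul, hP1] at key
    refine le_trans ?_ key
    have : 0 ≤ α - 1 := by linarith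
    have h5 := mul_le_mul_of_nonneg_left hp this
    have h6 : 1 ≤ 1 + (α-1) * (∑ x ∈ s, P x * Real.log (P x / Q x)) - 1 * c := by
      rw [hc]; linarith
    exact le_mul_of_one_le_right (Real.exp_pos c).le h6
  · apply sub_le_sub_right
    rw [hrw]
    have h3 := Real.rpow_arith_mean_le_arith_mean_rpow s P (fun x => P x / Q x)
      (fun x hx => (hP x hx).le) hP1 (fun x hx => (div_pos (hP x hx) (hQ x hx)).le)
      (p := α - 1) (by linarith)
    refine le_trans (Real.rpow_le_rpow (by positivity) ?_ (by linarith)) h3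
    have := aux_chi s P Q hQ hP1 hQ1
    rw [ht2] at this
    linarith
  · apply sub_le_sub_right
    push Not at h1
    have hα0 : 0 < α := by linarith
    have hαt : 1 ≤ t * α := by rwa [div_le_iff₀ hα0] at h1
    have ht0 : 0 < t := lt_of_lt_of_le (by positivity) h1
    set A := s.filter (fun x => Q x < P x) with hA
    have hAs : A ⊆ s := Finset.filter_subset _ _
    have hpq : ∑ x ∈ A, P x - ∑ x ∈ A, Q x = t := by
      have : ∑ x ∈ s, |P x - Q x|
          = ∑ x ∈ s, (2 * (if Q x < P x then P x - Q x else 0) - (P x - Q x)) := by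
        apply Finset.sum_congr rfl
        intro x _
        split_ifs with h
        · rw [abs_of_pos (by linarith)]; ring
        · rw [abs_of_nonpos (by linarith)]; ring
      rw [Finset.sum_sub_distrib, ← Finset.mul_sum, ← Finset.sum_filter,
        Finset.sum_sub_distrib, Finset.sum_sub_distrib, hP1, hQ1, ht2] at this
      linarith
    have hp1 : ∑ x ∈ A, P x ≤ 1 := by
      rw [← hP1]
      exact Finset.sum_le_sum_of_subset_of_nonneg hAs (fun x hx _ => (hP x hx).le)
    have hAne : A.Nonempty := by
      by_contra h
      rw [Finset.not_nonempty_iff_eq_empty] at h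
      rw [h] at hpq
      simp at hpq
      linarith
    have hq0 : 0 < ∑ x ∈ A, Q x := Finset.sum_pos (fun x hx => hQ x (hAs hx)) hAne
    have hb : 0 < 1 - t := by linarith
    have hsub : ∑ x ∈ A, Q x * (P x / Q x) ^ α ≤ ∑ x ∈ s, Q x * (P x / Q x) ^ α :=
      Finset.sum_le_sum_of_subset_of_nonneg hAs (fun x hx _ => by
        have := hP x hx
        have := hQ x hx
        positivity)
    refine le_trans ?_ hsub
    have key : ∑ x ∈ A, ((1-t)⁻¹)^(α-1) * (α * P x + (1-α) * (1-t)⁻¹ * Q x)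
        ≤ ∑ x ∈ A, Q x * (P x / Q x) ^ α := by
      apply Finset.sum_le_sum
      intro x hx
      have p := hP x (hAs hx)
      have q := hQ x (hAs hx)
      have := mul_le_mul_of_nonneg_left
        (aux_tangent α (P x / Q x) (1-t)⁻¹ hα (div_pos p q) (by positivity)) q.le
      refine le_trans (le_of_eq ?_) this
      field_simp
    rw [← Finset.mul_sum, Finset.sum_add_distrib, ← Finset.mul_sum, ← Finset.mul_sum] at key
    refine le_trans ?_ key
    have e : (1-t)^(1-α) = ((1-t)⁻¹)^(α-1) := by
      rw [Real.inv_rpow hb.le, ← Real.rpow_neg hb.le]; congr 1; ring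
    rw [e]
    apply le_mul_of_one_le_right (by positivity)
    have hq : ∑ x ∈ A, Q x = ∑ x ∈ A, P x - t := by linarith
    rw [hq]
    generalize ∑ x ∈ A, P x = p at *
    have e3 : α * p + (1-α) * (1-t)⁻¹ * (p - t) = (α * p * (1-t) + (1-α) * (p-t)) / (1-t) := by
      field_simp
    rw [e3, le_div_iff₀ hb]
    nlinarith [mul_nonneg (sub_nonneg.2 hαt) (sub_nonneg.2 hp1)]

/-- Pinsker's inequality for `f_α`-divergences: for `α > 1` and mutually
absolutely continuous distributions `P, Q` on a finite set, `D_{f_α}(P‖Q) ≥ g_α(t)` with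
`t = TV(P‖Q)`, where `g_α(t) = e^{2(α−1)t²} − 1` if `t < 1/α` and `α < 2`,
`g_α(t) = (4t² + 1)^{α−1} − 1` if `t < 1/α` and `α ≥ 2`, and
`g_α(t) = (1−t)^{1−α} − 1` otherwise. -/
theorem stmt_8 {X : Type*} [Fintype X] (α : ℝ) (hα : 1 < α)
    (P Q : X → ℝ) (hP0 : ∀ x, 0 ≤ P x) (hQ0 : ∀ x, 0 ≤ Q x)
    (hP1 : ∑ x, P x = 1) (hQ1 : ∑ x, Q x = 1)
    (hsupp : ∀ x, 0 < P x ↔ 0 < Q x)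
    (t : ℝ) (ht : t = (1 / 2) * ∑ x, |P x - Q x|) :
    (if t < 1 / α then
        (if α < 2 then Real.exp (2 * (α - 1) * t ^ 2) - 1
          else (4 * t ^ 2 + 1) ^ (α - 1) - 1)
      else (1 - t) ^ (1 - α) - 1) ≤
      (∑ x ∈ Finset.univ.filter (fun x => 0 < Q x), Q x * (P x / Q x) ^ α) - 1 := by
  have hz : ∀ x, ¬ 0 < Q x → P x = 0 ∧ Q x = 0 := fun x hx =>
    ⟨le_antisymm (not_lt.1 (fun h => hx ((hsupp x).1 h))) (hP0 x),
      le_antisymm (not_lt.1 hx) (hQ0 x)⟩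
  have hs : ∀ f : X → ℝ, (∀ x, ¬ 0 < Q x → f x = 0) →
      ∑ x ∈ Finset.univ.filter (fun x => 0 < Q x), f x = ∑ x, f x := by
    intro f hf
    apply Finset.sum_subset (Finset.filter_subset _ _)
    intro x _ hx
    exact hf x (fun h => hx (Finset.mem_filter.2 ⟨Finset.mem_univ _, h⟩))
  apply aux_main _ α hα P Q
  · intro x hx
    exact (hsupp x).2 (Finset.mem_filter.1 hx).2
  · intro x hx
    exact (Finset.mem_filter.1 hx).2
  · rw [hs P (fun x hx => (hz x hx).1), hP1]
  · rw [hs Q (fun x hx => (hz x hx).2), hQ1]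
  · rw [hs (fun x => |P x - Q x|) (fun x hx => by simp [hz x hx]), ht]
end

section
/- Let α > 1 and let t satisfy 1/α ≤ t < 1. Define ψ_α(p, t) = p^α/(p+t)^{α−1} + (1−p)^α/(1−p−t)^{α−1} − 1 for p ∈ [0, 1−t]. Then ψ_α(p, t) ≥ ψ_α(0, t) = (1−t)^{1−α} − 1 for every p ∈ [0, 1−t]; that is, the minimum of ψ_α(·, t) over [0, 1−t] is attained at p = 0 with value (1−t)^{1−α} − 1. -/
open Real

/-- For `α > 1` and `1/α ≤ t < 1`, the binary `f_α`-divergence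
`ψ_α(p,t) = p^α/(p+t)^{α−1} + (1−p)^α/(1−p−t)^{α−1} − 1` satisfies
`ψ_α(p,t) ≥ ψ_α(0,t) = (1−t)^{1−α} − 1` on `[0, 1−t)` (the right endpoint `p = 1−t`,
where the true value is `+∞` by the limit convention, is excluded). -/
theorem stmt_9 (α : ℝ) (hα : 1 < α) (t : ℝ) (ht1 : 1 / α ≤ t) (ht2 : t < 1) :
    (∀ p ∈ Set.Ico (0:ℝ) (1 - t),
        (1 - t) ^ (1 - α) - 1 ≤
          p ^ α / (p + t) ^ (α - 1) + (1 - p) ^ α / (1 - p - t) ^ (α - 1) - 1) ∧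
      (0:ℝ) ^ α / ((0:ℝ) + t) ^ (α - 1) +
          (1 - (0:ℝ)) ^ α / (1 - (0:ℝ) - t) ^ (α - 1) - 1 =
        (1 - t) ^ (1 - α) - 1 := by
  have hα0 : 0 < α := by linarith
  have ht0 : 0 < t := lt_of_lt_of_le (by positivity) ht1
  have h1t : 0 < 1 - t := by linarith
  constructor
  · rintro p ⟨hp0, hp1⟩
    obtain ⟨q, hq⟩ : ∃ q, q = 1 - p := ⟨_, rfl⟩
    rw [← hq]
    have hqt : 0 < q - t := by linarith
    have hq0 : 0 < q := by linarith
    have hq1 : q ≤ 1 := by linarith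
    have hfirst : 0 ≤ p ^ α / (p + t) ^ (α - 1) := by positivity
    obtain ⟨x, hx⟩ : ∃ x, x = (q - t) / (q * (1 - t)) := ⟨_, rfl⟩
    have hx0 : 0 < x := by rw [hx]; positivity
    have hxy : x ≤ 1 / q := by
      rw [hx, div_le_div_iff₀ (by positivity) hq0]
      nlinarith
    have hsum : (1 - t) * x + t * (1 / q) = 1 := by
      rw [hx]; field_simp; ring
    have hs1 : 1 / α ≤ 1 := by rw [div_le_one hα0]; linarith
    have hgm := Real.geom_mean_le_arith_mean2_weighted (w₁ := 1 - 1 / α) (w₂ := 1 / α)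
      (p₁ := x) (p₂ := 1 / q) (by linarith) (by positivity) hx0.le (by positivity) (by ring)
    have hle : x ^ (1 - 1 / α) * (1 / q) ^ (1 / α) ≤ 1 := by
      nlinarith [mul_nonneg (sub_nonneg.2 ht1) (sub_nonneg.2 hxy)]
    have hpow := Real.rpow_le_one (by positivity) hle hα0.le
    rw [Real.mul_rpow (by positivity) (by positivity), ← Real.rpow_mul hx0.le,
      ← Real.rpow_mul (by positivity)] at hpow
    have e1 : (1 - 1 / α) * α = α - 1 := by field_simp
    have e2 : 1 / α * α = 1 := by field_simp
    rw [e1, e2, Real.rpow_one, mul_one_div, div_le_one hq0] at hpow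
    have hqx : q - t = x * q * (1 - t) := by rw [hx]; field_simp
    have hA : (q - t) ^ (α - 1) ≤ q ^ α * (1 - t) ^ (α - 1) := by
      rw [hqx, Real.mul_rpow (by positivity) h1t.le, Real.mul_rpow hx0.le hq0.le]
      have : q ^ α = q * q ^ (α - 1) := by
        rw [Real.rpow_sub_one hq0.ne']; field_simp
      rw [this]
      gcongr
    have hB : (1 - t) ^ (1 - α) ≤ q ^ α / (q - t) ^ (α - 1) := by
      rw [← neg_sub α 1, Real.rpow_neg h1t.le, le_div_iff₀ (by positivity),
        inv_mul_le_iff₀ (by positivity)]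
      linarith
    linarith
  · rw [Real.zero_rpow hα0.ne', ← neg_sub α 1, Real.rpow_neg h1t.le]
    simp
end

section
/- Let α > 1 and t ∈ (0, 1). Then the function p ↦ ψ_α(p, t) = p^α/(p+t)^{α−1} + (1−p)^α/(1−p−t)^{α−1} − 1 is convex on the interval [0, 1−t]. -/
open Real

lemma persp_eq (α x y : ℝ) (hx : 0 ≤ x) (hy : 0 < y) :
    x ^ α / y ^ (α - 1) = y * (x / y) ^ α := by
  rw [Real.div_rpow hx hy.le, Real.rpow_sub hy, Real.rpow_one]
  have := Real.rpow_pos_of_pos hy α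
  field_simp

lemma persp_conv (α : ℝ) (hα : 1 < α) (x₁ x₂ y₁ y₂ a b : ℝ) (hx₁ : 0 ≤ x₁) (hx₂ : 0 ≤ x₂)
    (hy₁ : 0 < y₁) (hy₂ : 0 < y₂) (ha : 0 ≤ a) (hb : 0 ≤ b) (hY : 0 < a * y₁ + b * y₂) :
    (a * x₁ + b * x₂) ^ α / (a * y₁ + b * y₂) ^ (α - 1) ≤
      a * (x₁ ^ α / y₁ ^ (α - 1)) + b * (x₂ ^ α / y₂ ^ (α - 1)) := by
  rw [persp_eq α _ _ (by positivity) hY, persp_eq α _ _ hx₁ hy₁, persp_eq α _ _ hx₂ hy₂]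
  set Y := a * y₁ + b * y₂ with hYd
  have hA : 0 ≤ a * y₁ / Y := by positivity
  have hB : 0 ≤ b * y₂ / Y := by positivity
  have hX1 : x₁ / y₁ ∈ Set.Ici (0:ℝ) := Set.mem_Ici.2 (by positivity)
  have hX2 : x₂ / y₂ ∈ Set.Ici (0:ℝ) := Set.mem_Ici.2 (by positivity)
  have h := (convexOn_rpow hα.le).2 hX1 hX2 hA hB
    (by rw [← add_div, ← hYd, div_self hY.ne'])
  simp only [smul_eq_mul] at h
  have e : a * y₁ / Y * (x₁ / y₁) + b * y₂ / Y * (x₂ / y₂) = (a * x₁ + b * x₂) / Y := by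
    field_simp
  rw [e] at h
  calc Y * ((a * x₁ + b * x₂) / Y) ^ α
      ≤ Y * (a * y₁ / Y * (x₁ / y₁) ^ α + b * y₂ / Y * (x₂ / y₂) ^ α) :=
        mul_le_mul_of_nonneg_left h hY.le
    _ = _ := by field_simp

/-- For `α > 1` and `t ∈ (0,1)`, the binary `f_α`-divergence
`p ↦ ψ_α(p,t) = p^α/(p+t)^{α−1} + (1−p)^α/(1−p−t)^{α−1} − 1` is convex on `[0, 1−t)`
(the right endpoint `p = 1−t`, where the true value is `+∞` by the continuity/limit
convention, is excluded). -/
theorem stmt_10 (α : ℝ) (hα : 1 < α) (t : ℝ) (ht0 : 0 < t) (ht1 : t < 1) :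
    ConvexOn ℝ (Set.Ico (0:ℝ) (1 - t))
      (fun p : ℝ =>
        p ^ α / (p + t) ^ (α - 1) + (1 - p) ^ α / (1 - p - t) ^ (α - 1) - 1) := by
  refine ⟨convex_Ico _ _, ?_⟩
  rintro p ⟨hp0, hp1⟩ q ⟨hq0, hq1⟩ a b ha hb hab
  simp only [smul_eq_mul]
  have hpos : ∀ u v : ℝ, 0 < u → 0 < v → 0 < a * u + b * v := by
    intro u v hu hv
    rcases ha.eq_or_lt with h | h
    · have : b = 1 := by linarith
      rw [← h, this]; linarith
    · have := mul_pos h hu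
      have := mul_nonneg hb hv.le
      linarith
  have hb' : b = 1 - a := by linarith
  have h1 := persp_conv α hα p q (p + t) (q + t) a b hp0 hq0 (by linarith) (by linarith) ha hb
    (hpos _ _ (by linarith) (by linarith))
  have h2 := persp_conv α hα (1 - p) (1 - q) (1 - p - t) (1 - q - t) a b (by linarith)
    (by linarith) (by linarith) (by linarith) ha hb (hpos _ _ (by linarith) (by linarith))
  have e1 : a * (p + t) + b * (q + t) = a * p + b * q + t := by rw [hb']; ring
  have e2 : a * (1 - p) + b * (1 - q) = 1 - (a * p + b * q) := by rw [hb']; ring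
  have e3 : a * (1 - p - t) + b * (1 - q - t) = 1 - (a * p + b * q) - t := by rw [hb']; ring
  rw [e1] at h1
  rw [e2, e3] at h2
  linarith
end

section
/- Let α ≥ 2 and t ∈ (0, 1). Then for every p ∈ [0, 1−t], ψ_α(p, t) = p^α/(p+t)^{α−1} + (1−p)^α/(1−p−t)^{α−1} − 1 ≥ (1 + t²/((p+t)(1−p−t)))^{α−1} − 1 ≥ (1 + 4t²)^{α−1} − 1. -/
open Real

/-- For `α ≥ 2` and `t ∈ (0,1)`, the binary `f_α`-divergence satisfies
`ψ_α(p,t) ≥ (1 + t²/((p+t)(1−p−t)))^{α−1} − 1 ≥ (1 + 4t²)^{α−1} − 1` for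
`p ∈ [0, 1−t)` (the right endpoint, interpreted by its limit `+∞`, is excluded). -/
theorem stmt_11 (α : ℝ) (hα : 2 ≤ α) (t : ℝ) (ht0 : 0 < t) (ht1 : t < 1) :
    ∀ p ∈ Set.Ico (0:ℝ) (1 - t),
      (1 + t ^ 2 / ((p + t) * (1 - p - t))) ^ (α - 1) - 1 ≤
          p ^ α / (p + t) ^ (α - 1) + (1 - p) ^ α / (1 - p - t) ^ (α - 1) - 1 ∧
        (1 + 4 * t ^ 2) ^ (α - 1) - 1 ≤
          (1 + t ^ 2 / ((p + t) * (1 - p - t))) ^ (α - 1) - 1 := by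
  rintro p ⟨hp0, hp1⟩
  have hq : 0 < p + t := by linarith
  have hr : 0 < 1 - p - t := by linarith
  have h1p : 0 < 1 - p := by linarith
  have key : ∀ x y : ℝ, 0 ≤ x → 0 < y →
      x ^ α / y ^ (α - 1) = x * (x / y) ^ (α - 1) := by
    intro x y hx hy
    rw [Real.div_rpow hx hy.le, mul_div_assoc']
    congr 1
    rcases hx.eq_or_lt with h | h
    · rw [← h, Real.zero_rpow (by linarith), zero_mul]
    · rw [Real.rpow_sub_one h.ne']
      field_simp
  constructor
  · rw [key p _ hp0 hq, key (1 - p) _ h1p.le hr]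
    have hx : p / (p + t) ∈ Set.Ici (0:ℝ) := div_nonneg hp0 hq.le
    have hy : (1 - p) / (1 - p - t) ∈ Set.Ici (0:ℝ) := div_nonneg h1p.le hr.le
    have h := (convexOn_rpow (p := α - 1) (by linarith)).2 hx hy hp0 h1p.le (by ring)
    simp only [smul_eq_mul] at h
    have e : p * (p / (p + t)) + (1 - p) * ((1 - p) / (1 - p - t))
        = 1 + t ^ 2 / ((p + t) * (1 - p - t)) := by
      field_simp
      ring
    rw [e] at h
    linarith
  · have h : 4 * t ^ 2 ≤ t ^ 2 / ((p + t) * (1 - p - t)) := by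
      rw [le_div_iff₀ (by positivity)]
      nlinarith [mul_nonneg (sq_nonneg t) (sq_nonneg (2 * (p + t) - 1))]
    have := Real.rpow_le_rpow (z := α - 1) (by positivity)
      (add_le_add_right h 1) (by linarith)
    linarith
end

section
/- Let ε > 0, let m ≥ 2 and k ≥ 1 be integers, and set N = m·k. Let P be the N×N randomized response mechanism P(x|w) = e^ε/(N + e^ε − 1) if x = w and 1/(N + e^ε − 1) otherwise, and let Q be the N×N block-diagonal channel with m diagonal blocks each equal to the k×k matrix with all entries 1/k (i.e., Q(y|x) = 1/k if x and y lie in the same block of k consecutive indices, and 0 otherwise). Let M = Q∘P denote the composed channel, with rows M_w(y) = Σ_x Q(y|x) P(x|w). Then max over w, w' ∈ {1,…,N} and y ∈ {1,…,N} of M_w(y)/M_{w'}(y) equals 1 + (e^ε − 1)/k, and min over w, w', y of M_w(y)/M_{w'}(y) equals (1 + (e^ε − 1)/k)^{-1}. -/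
open Real

lemma block_sum (m k : ℕ) (hk : 1 ≤ k) (y : Fin (m * k)) :
    ∑ x : Fin (m * k), (if x.val / k = y.val / k then 1 / (k : ℝ) else 0) = 1 := by
  have hk0 : (k : ℝ) ≠ 0 := by positivity
  have hy : y.val / k < m := Nat.div_lt_of_lt_mul (lt_of_lt_of_eq y.isLt (mul_comm m k))
  rw [← Equiv.sum_comp finProdFinEquiv, Fintype.sum_prod_type]
  have h : ∀ (a : Fin m) (b : Fin k),
      (finProdFinEquiv (a, b)).val / k = a.val := by
    intro a b
    simp only [finProdFinEquiv_apply_val]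
    rw [Nat.add_mul_div_left _ _ (by omega), Nat.div_eq_of_lt b.isLt, zero_add]
  simp only [h]
  rw [Finset.sum_eq_single (⟨y.val / k, hy⟩ : Fin m)]
  · simp [hk0]
  · intro a _ ha
    have : a.val ≠ y.val / k := fun h => ha (Fin.ext h)
    simp [this]
  · simp

/-- For the `N×N` randomized response mechanism `P` with parameter `ε`
(`N = m·k`) composed with the block-diagonal channel `Q` of `m` uniform `k×k` blocks
(indices `x, y` lie in the same block iff `⌊x/k⌋ = ⌊y/k⌋`), the maximum of
`M_w(y)/M_{w'}(y)` over all `w, w', y` equals `1 + (e^ε − 1)/k` and the minimum equals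
`(1 + (e^ε − 1)/k)⁻¹`, where `M_w(y) = Σ_x Q(y|x) P(x|w)`. -/
theorem stmt_15 (ε : ℝ) (hε : 0 < ε) (m k : ℕ) (hm : 2 ≤ m) (hk : 1 ≤ k)
    (P : Fin (m * k) → Fin (m * k) → ℝ)
    (hP : P = fun w x => if x = w then Real.exp ε / ((m * k : ℕ) + Real.exp ε - 1)
      else 1 / ((m * k : ℕ) + Real.exp ε - 1))
    (Q : Fin (m * k) → Fin (m * k) → ℝ)
    (hQ : Q = fun x y => if x.val / k = y.val / k then 1 / (k : ℝ) else 0)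
    (M : Fin (m * k) → Fin (m * k) → ℝ)
    (hM : M = fun w y => ∑ x, Q x y * P w x) :
    IsGreatest {r : ℝ | ∃ w w' y, r = M w y / M w' y} (1 + (Real.exp ε - 1) / k) ∧
      IsLeast {r : ℝ | ∃ w w' y, r = M w y / M w' y} (1 + (Real.exp ε - 1) / k)⁻¹ := by
  obtain ⟨c, hc⟩ : ∃ c, c = 1 + (Real.exp ε - 1) / k := ⟨_, rfl⟩
  obtain ⟨D, hD⟩ : ∃ D : ℝ, D = ((m * k : ℕ) + Real.exp ε - 1) := ⟨_, rfl⟩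
  have he : 1 < Real.exp ε := Real.one_lt_exp_iff.mpr hε
  have hkpos : (0 : ℝ) < k := by exact_mod_cast hk
  have hDpos : 0 < D := by
    have : (0 : ℝ) ≤ ((m * k : ℕ) : ℝ) := Nat.cast_nonneg _
    rw [hD]; linarith
  have hc1 : 1 < c := by
    have : 0 < (Real.exp ε - 1) / k := div_pos (by linarith) hkpos
    linarith
  have hMv : ∀ w y, M w y = (if w.val / k = y.val / k then c else 1) / D := by
    intro w y
    have h1 : M w y = ∑ x, (1 / D * (if x.val / k = y.val / k then 1 / (k : ℝ) else 0) +
        if x = w then (if x.val / k = y.val / k then 1 / (k : ℝ) else 0) *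
          ((Real.exp ε - 1) / D) else 0) := by
      rw [hM, hQ, hP]
      simp only [← hD]
      refine Finset.sum_congr rfl fun x _ => ?_
      by_cases hx : x = w
      · simp only [hx, if_true]; ring
      · simp only [hx, if_false]; ring
    rw [h1, Finset.sum_add_distrib, ← Finset.mul_sum, block_sum m k hk y,
      Finset.sum_ite_eq' Finset.univ w, if_pos (Finset.mem_univ w), hc]
    split_ifs <;> ring
  have hr : ∀ w w' y, M w y / M w' y =
      (if w.val / k = y.val / k then c else 1) / (if w'.val / k = y.val / k then c else 1) := by
    intro w w' y
    rw [hMv, hMv, div_div_div_cancel_right₀ hDpos.ne']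
  have hkm : k < m * k := by nlinarith
  have h01 : ¬ (k / k = 0 / k) := by
    rw [Nat.div_self (by omega), Nat.zero_div]; omega
  have hci : c⁻¹ < 1 := inv_lt_one_of_one_lt₀ hc1
  have hc0 : c ≠ 0 := by linarith
  rw [← hc]
  refine ⟨⟨⟨⟨0, by omega⟩, ⟨k, hkm⟩, ⟨0, by omega⟩, ?_⟩, ?_⟩,
    ⟨⟨⟨k, hkm⟩, ⟨0, by omega⟩, ⟨0, by omega⟩, ?_⟩, ?_⟩⟩
  · rw [hr, if_pos rfl, if_neg h01, div_one]
  · rintro r ⟨w, w', y, rfl⟩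
    rw [hr]
    split_ifs <;> simp [hc0] <;> linarith
  · rw [hr, if_pos rfl, if_neg h01, one_div]
  · rintro r ⟨w, w', y, rfl⟩
    rw [hr]
    split_ifs
    · rw [div_self hc0]; linarith
    · rw [div_one]; linarith
    · rw [one_div]
    · rw [div_one]; linarith
end

section
/- Let ε > 0, α > 1, let m ≥ 2 be a fixed integer, and for each integer k ≥ 1 set N = m·k. Let P^{(N)} be the N×N randomized response mechanism P^{(N)}(x|w) = e^ε/(N + e^ε − 1) if x = w and 1/(N + e^ε − 1) otherwise, and let Q^{(m,k)} be the N×N block-diagonal channel with m diagonal blocks each equal to the k×k matrix with all entries 1/k. Let M^{(k)} = Q^{(m,k)}∘P^{(N)} be the composed channel with rows M^{(k)}_w. Then for all w, w' ∈ {1,…,N}, D_α(M^{(k)}_w ‖ M^{(k)}_{w'}) ≤ log(1 + (e^ε − 1)/k); consequently, the α-Rényi local differential privacy level max_{w,w'} D_α(M^{(k)}_w ‖ M^{(k)}_{w'}) of the composed channel tends to 0 as k → ∞. -/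
open Real

theorem aux_fib (m k : ℕ) (hk : 1 ≤ k) (b : ℕ) (hb : b < m) (c : ℝ) :
    (∑ x : Fin (m * k), (if x.val / k = b then c else 0)) = k * c := by
  rw [← finProdFinEquiv.sum_comp, Fintype.sum_prod_type]
  have h : ∀ (i : Fin m) (j : Fin k),
      ((finProdFinEquiv (i, j) : Fin (m * k)).val / k = b) ↔ i = ⟨b, hb⟩ := by
    intro i j
    have : (finProdFinEquiv (i, j) : Fin (m * k)).val = j.val + k * i.val := rfl
    rw [this, Nat.add_mul_div_left _ _ (by omega), Nat.div_eq_of_lt j.2, Fin.ext_iff]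
    simp
  simp only [h]
  simp [Finset.sum_ite_eq]

theorem aux_M (m k : ℕ) (hk : 1 ≤ k) (e p : ℝ) (w y : Fin (m * k)) :
    (∑ x : Fin (m * k), (if x.val / k = y.val / k then 1 / (k : ℝ) else 0) *
        (if x = w then e / p else 1 / p)) =
    1 / p + (if y.val / k = w.val / k then (e - 1) / k / p else 0) := by
  have hk' : (k : ℝ) ≠ 0 := by positivity
  have h1 : ∀ x : Fin (m * k), (if x.val / k = y.val / k then 1 / (k : ℝ) else 0) *
        (if x = w then e / p else 1 / p) =
      (if x.val / k = y.val / k then 1 / (k : ℝ) * (1 / p) else 0) +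
      (if x = w then (if y.val / k = w.val / k then (e - 1) / k / p else 0) else 0) := by
    intro x
    by_cases hx : x = w
    · subst hx
      by_cases h : x.val / k = y.val / k
      · simp only [h, if_true]; ring
      · simp [h, Ne.symm h]
    · simp only [hx, if_false]
      split_ifs <;> ring
  simp only [h1]
  rw [Finset.sum_add_distrib, aux_fib m k hk _ (Nat.div_lt_of_lt_mul (lt_of_lt_of_eq y.2 (mul_comm m k)))]
  simp only [Finset.sum_ite_eq', Finset.mem_univ, if_true]
  field_simp

/-- Composing the `N×N` randomized response mechanism (`N = m·k`) with the
block-diagonal channel of `m` uniform `k×k` blocks yields rows `M^{(k)}_w` with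
`D_α(M^{(k)}_w ‖ M^{(k)}_{w'}) ≤ log(1 + (e^ε − 1)/k)` for all `w, w'`; consequently the
α-Rényi-LDP level `max_{w,w'} D_α(M^{(k)}_w ‖ M^{(k)}_{w'})` tends to `0` as `k → ∞`. -/
theorem stmt_16 (ε : ℝ) (hε : 0 < ε) (α : ℝ) (hα : 1 < α) (m : ℕ) (hm : 2 ≤ m)
    (M : (k : ℕ) → Fin (m * k) → Fin (m * k) → ℝ)
    (hM : ∀ k : ℕ, M k = fun w y => ∑ x : Fin (m * k),
      (if x.val / k = y.val / k then 1 / (k : ℝ) else 0) *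
        (if x = w then Real.exp ε / ((m * k : ℕ) + Real.exp ε - 1)
          else 1 / ((m * k : ℕ) + Real.exp ε - 1)))
    (D : (k : ℕ) → Fin (m * k) → Fin (m * k) → ℝ)
    (hD : ∀ k : ℕ, D k = fun w w' =>
      (α - 1)⁻¹ * Real.log (∑ y, (M k w y) ^ α * (M k w' y) ^ (1 - α))) :
    (∀ k : ℕ, 1 ≤ k → ∀ w w' : Fin (m * k),
        D k w w' ≤ Real.log (1 + (Real.exp ε - 1) / k)) ∧
      Filter.Tendsto (fun k : ℕ => sSup {r : ℝ | ∃ w w' : Fin (m * k), r = D k w w'})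
        Filter.atTop (nhds 0) := by
  have hE : 0 < Real.exp ε - 1 := by
    have := Real.add_one_lt_exp hε.ne'
    linarith
  have hα1 : 0 < α - 1 := by linarith
  have hN : ∀ k : ℕ, 0 < ((m * k : ℕ) : ℝ) + Real.exp ε - 1 := fun k => by
    have : (0 : ℝ) ≤ ((m * k : ℕ) : ℝ) := Nat.cast_nonneg _
    linarith
  have hM' : ∀ k : ℕ, 1 ≤ k → ∀ w y, M k w y = 1 / ((m * k : ℕ) + Real.exp ε - 1) +
      (if y.val / k = w.val / k then
        (Real.exp ε - 1) / k / ((m * k : ℕ) + Real.exp ε - 1) else 0) := by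
    intro k hk w y
    rw [hM k]
    exact aux_M m k hk _ _ w y
  have hlo : ∀ k : ℕ, 1 ≤ k → ∀ w y, 1 / ((m * k : ℕ) + Real.exp ε - 1) ≤ M k w y := by
    intro k hk w y
    rw [hM' k hk]
    have := hN k
    split_ifs
    · have : 0 ≤ (Real.exp ε - 1) / k / ((m * k : ℕ) + Real.exp ε - 1) := by positivity
      linarith
    · simp
  have hhi : ∀ k : ℕ, 1 ≤ k → ∀ w y, M k w y ≤
      (1 + (Real.exp ε - 1) / k) * (1 / ((m * k : ℕ) + Real.exp ε - 1)) := by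
    intro k hk w y
    rw [hM' k hk]
    have := hN k
    have h2 : 0 ≤ (Real.exp ε - 1) / k / ((m * k : ℕ) + Real.exp ε - 1) := by positivity
    have h3 : (1 + (Real.exp ε - 1) / k) * (1 / ((m * k : ℕ) + Real.exp ε - 1)) =
      1 / ((m * k : ℕ) + Real.exp ε - 1) +
        (Real.exp ε - 1) / k / ((m * k : ℕ) + Real.exp ε - 1) := by ring
    rw [h3]
    split_ifs <;> linarith
  have hpos : ∀ k : ℕ, 1 ≤ k → ∀ w y, 0 < M k w y := fun k hk w y =>
    lt_of_lt_of_le (by have := hN k; positivity) (hlo k hk w y)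
  have hsum : ∀ k : ℕ, 1 ≤ k → ∀ w, ∑ y, M k w y = 1 := by
    intro k hk w
    have hk' : (k : ℝ) ≠ 0 := by positivity
    have hn := (hN k).ne'
    simp only [hM' k hk]
    rw [Finset.sum_add_distrib,
      aux_fib m k hk _ (Nat.div_lt_of_lt_mul (lt_of_lt_of_eq w.2 (mul_comm m k)))]
    simp only [Finset.sum_const, Finset.card_univ, Fintype.card_fin, nsmul_eq_mul]
    field_simp
    ring
  have hbound : ∀ k : ℕ, 1 ≤ k → ∀ w w' : Fin (m * k),
      D k w w' ≤ Real.log (1 + (Real.exp ε - 1) / k) := by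
    intro k hk w w'
    have hr : 0 < 1 + (Real.exp ε - 1) / (k : ℝ) := by positivity
    have hS : ∑ y, (M k w y) ^ α * (M k w' y) ^ (1 - α) ≤
        (1 + (Real.exp ε - 1) / (k : ℝ)) ^ (α - 1) := by
      calc _ ≤ ∑ y, M k w y * (1 + (Real.exp ε - 1) / (k : ℝ)) ^ (α - 1) := by
            apply Finset.sum_le_sum
            intro y _
            have h1 := hpos k hk w y
            have h2 := hpos k hk w' y
            have e1 : (M k w y) ^ α * (M k w' y) ^ (1 - α) =
                M k w y * (M k w y / M k w' y) ^ (α - 1) := by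
              rw [Real.div_rpow h1.le h2.le, show (1 - α) = -(α - 1) by ring,
                Real.rpow_neg h2.le]
              nth_rewrite 1 [show α = 1 + (α - 1) by ring]
              rw [Real.rpow_add h1, Real.rpow_one]
              ring
            rw [e1]
            refine mul_le_mul_of_nonneg_left ?_ h1.le
            refine Real.rpow_le_rpow (by positivity) ?_ hα1.le
            rw [div_le_iff₀ h2]
            exact (hhi k hk w y).trans (mul_le_mul_of_nonneg_left (hlo k hk w' y) hr.le)
        _ = _ := by rw [← Finset.sum_mul, hsum k hk, one_mul]
    have hSpos : 0 < ∑ y, (M k w y) ^ α * (M k w' y) ^ (1 - α) :=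
      Finset.sum_pos (fun y _ => mul_pos (Real.rpow_pos_of_pos (hpos k hk w y) _)
        (Real.rpow_pos_of_pos (hpos k hk w' y) _)) ⟨w, Finset.mem_univ _⟩
    have hl := Real.log_le_log hSpos hS
    rw [Real.log_rpow hr] at hl
    simp only [hD]
    rw [inv_mul_le_iff₀ hα1]
    exact hl
  refine ⟨hbound, ?_⟩
  have hlim : Filter.Tendsto (fun k : ℕ => Real.log (1 + (Real.exp ε - 1) / (k : ℝ)))
      Filter.atTop (nhds 0) := by
    have h1 : Filter.Tendsto (fun k : ℕ => 1 + (Real.exp ε - 1) / (k : ℝ))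
        Filter.atTop (nhds (1 + 0)) :=
      tendsto_const_nhds.add (tendsto_const_div_atTop_nhds_zero_nat _)
    rw [add_zero] at h1
    have := h1.log one_ne_zero
    rwa [Real.log_one] at this
  refine tendsto_of_tendsto_of_tendsto_of_le_of_le' tendsto_const_nhds hlim ?_ ?_
  · filter_upwards [Filter.eventually_ge_atTop 1] with k hk
    have hmk : 0 < m * k := by positivity
    have h0 : D k ⟨0, hmk⟩ ⟨0, hmk⟩ = 0 := by
      simp only [hD]
      have : ∀ y, (M k ⟨0, hmk⟩ y) ^ α * (M k ⟨0, hmk⟩ y) ^ (1 - α) = M k ⟨0, hmk⟩ y := by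
        intro y
        rw [← Real.rpow_add (hpos k hk _ y)]
        simp
      simp only [this, hsum k hk, Real.log_one, mul_zero]
    refine le_csSup ⟨Real.log (1 + (Real.exp ε - 1) / k), ?_⟩ ⟨_, _, h0.symm⟩
    rintro r ⟨w, w', rfl⟩
    exact hbound k hk w w'
  · filter_upwards [Filter.eventually_ge_atTop 1] with k hk
    have hmk : 0 < m * k := by positivity
    refine csSup_le ⟨_, ⟨0, hmk⟩, ⟨0, hmk⟩, rfl⟩ ?_
    rintro r ⟨w, w', rfl⟩
    exact hbound k hk w w'
end

section
/- Let α > 1, let m ≥ 2, and let K be a channel from a finite set 𝒳 to a finite set 𝒴 whose matrix is block-diagonal: there are partitions 𝒳 = 𝒳_1 ∪ … ∪ 𝒳_m and 𝒴 = 𝒴_1 ∪ … ∪ 𝒴_m into nonempty parts such that K(y|x) = 0 whenever x ∈ 𝒳_i and y ∈ 𝒴_j with i ≠ j. Then the supremum, over all pairs (P, Q) of strictly positive probability distributions on 𝒳 with P ≠ Q, of D_α(K∘P ‖ K∘Q) / D_α(P ‖ Q) equals 1. -/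
open Real

lemma s17_tangent (α : ℝ) (hα : 1 < α) (p q s : ℝ) (hp : 0 < p) (hq : 0 < q) (hs : 0 < s) :
    s ^ α * q + α * s ^ (α - 1) * (p - s * q) ≤ p ^ α * q ^ (1 - α) ∧
    (p ≠ s * q → s ^ α * q + α * s ^ (α - 1) * (p - s * q) < p ^ α * q ^ (1 - α)) := by
  have hsa : s ^ α = s ^ (α - 1) * s := by
    rw [← rpow_add_one hs.ne']; ring_nf
  have hpos : 0 < s ^ α * q := by positivity
  have h1 : p ^ α * q ^ (1 - α) = s ^ α * q * (1 + (p / (s * q) - 1)) ^ α := by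
    rw [add_sub_cancel, div_rpow hp.le (by positivity), mul_rpow hs.le hq.le,
      rpow_sub hq, rpow_one]
    field_simp
  have h2 : s ^ α * q + α * s ^ (α - 1) * (p - s * q)
      = s ^ α * q * (1 + α * (p / (s * q) - 1)) := by
    rw [hsa]; field_simp
    try ring
  have h3 : -1 ≤ p / (s * q) - 1 := by
    have : 0 < p / (s * q) := by positivity
    linarith
  rw [h1, h2]
  refine ⟨mul_le_mul_of_nonneg_left (one_add_mul_self_le_rpow_one_add h3 hα.le) hpos.le,
    fun h => mul_lt_mul_of_pos_left (one_add_mul_self_lt_rpow_one_add h3 ?_ hα) hpos⟩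
  intro h0
  apply h
  have : p / (s * q) = 1 := by linarith
  rwa [div_eq_one_iff_eq (by positivity)] at this

lemma s17_gt {X : Type*} [Fintype X] (α : ℝ) (hα : 1 < α) (P Q : X → ℝ)
    (hP : ∀ z, 0 < P z) (hQ : ∀ z, 0 < Q z) (hP1 : ∑ z, P z = 1) (hQ1 : ∑ z, Q z = 1)
    (hne : P ≠ Q) : 1 < ∑ z, P z ^ α * Q z ^ (1 - α) := by
  obtain ⟨x, hx⟩ := Function.ne_iff.mp hne
  have : ∑ z, (Q z + α * (P z - Q z)) < ∑ z, P z ^ α * Q z ^ (1 - α) := by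
    apply Finset.sum_lt_sum
    · intro z _
      simpa using (s17_tangent α hα (P z) (Q z) 1 (hP z) (hQ z) one_pos).1
    · exact ⟨x, Finset.mem_univ _, by
        simpa using (s17_tangent α hα (P x) (Q x) 1 (hP x) (hQ x) one_pos).2 (by simpa using hx)⟩
  rw [Finset.sum_add_distrib, ← Finset.mul_sum, Finset.sum_sub_distrib, hP1, hQ1] at this
  linarith

lemma s17_persp {X : Type*} [Fintype X] (α : ℝ) (hα : 1 < α) (P Q k : X → ℝ)
    (hP : ∀ z, 0 < P z) (hQ : ∀ z, 0 < Q z) (hk : ∀ z, 0 ≤ k z) :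
    (∑ z, k z * P z) ^ α * (∑ z, k z * Q z) ^ (1 - α)
      ≤ ∑ z, k z * (P z ^ α * Q z ^ (1 - α)) := by
  by_cases h0 : ∀ z, k z = 0
  · simp [h0, zero_rpow (show α ≠ 0 by linarith)]
  push Not at h0
  obtain ⟨x, hx⟩ := h0
  have hx' : 0 < k x := lt_of_le_of_ne (hk x) (Ne.symm hx)
  have hA : 0 < ∑ z, k z * P z :=
    Finset.sum_pos' (fun z _ => mul_nonneg (hk z) (hP z).le) ⟨x, Finset.mem_univ _, mul_pos hx' (hP x)⟩
  have hB : 0 < ∑ z, k z * Q z :=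
    Finset.sum_pos' (fun z _ => mul_nonneg (hk z) (hQ z).le) ⟨x, Finset.mem_univ _, mul_pos hx' (hQ x)⟩
  set A := ∑ z, k z * P z with hAd
  set B := ∑ z, k z * Q z with hBd
  have hs : 0 < A / B := by positivity
  set s := A / B with hsd
  have hAB : A = s * B := by rw [hsd]; field_simp
  calc A ^ α * B ^ (1 - α) = s ^ α * B := by
        rw [hsd, div_rpow hA.le hB.le, rpow_sub hB, rpow_one]; field_simp
    _ = s ^ α * B + α * s ^ (α - 1) * (A - s * B) := by rw [hAB]; ring
    _ = ∑ z, k z * (s ^ α * Q z + α * s ^ (α - 1) * (P z - s * Q z)) := by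
        rw [hAd, hBd, mul_sub, Finset.mul_sum, Finset.mul_sum, Finset.mul_sum, Finset.mul_sum,
          ← Finset.sum_sub_distrib, ← Finset.sum_add_distrib]
        exact Finset.sum_congr rfl fun z _ => by ring
    _ ≤ _ := Finset.sum_le_sum fun z _ =>
        mul_le_mul_of_nonneg_left (s17_tangent α hα _ _ s (hP z) (hQ z) hs).1 (hk z)

/-- A block-diagonal channel (w.r.t. partitions of `X` and `Y` into `m ≥ 2`
nonempty parts, with `K(y|x) = 0` whenever `x` and `y` lie in parts of different index)
does not contract the Rényi divergence of any order `α > 1`: the supremum over strictly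
positive `P ≠ Q` of `D_α(K∘P ‖ K∘Q)/D_α(P ‖ Q)` equals `1`. -/
theorem stmt_17 {X Y : Type*} [Fintype X] [Fintype Y] (α : ℝ) (hα : 1 < α)
    (m : ℕ) (hm : 2 ≤ m)
    (K : X → Y → ℝ) (hK0 : ∀ x y, 0 ≤ K x y) (hK1 : ∀ x, ∑ y, K x y = 1)
    (cX : X → Fin m) (cY : Y → Fin m)
    (hcX : Function.Surjective cX) (hcY : Function.Surjective cY)
    (hblock : ∀ x y, cX x ≠ cY y → K x y = 0) :
    sSup {r : ℝ |
      ∃ P Q : X → ℝ, (∀ z, 0 < P z) ∧ (∀ z, 0 < Q z) ∧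
        (∑ z, P z) = 1 ∧ (∑ z, Q z) = 1 ∧ P ≠ Q ∧
        r = ((α - 1)⁻¹ *
              Real.log (∑ y, (∑ z, K z y * P z) ^ α * (∑ z, K z y * Q z) ^ (1 - α))) /
            ((α - 1)⁻¹ * Real.log (∑ z, P z ^ α * Q z ^ (1 - α)))} = 1 := by
  have hα' : 0 < (α - 1)⁻¹ := inv_pos.mpr (by linarith)
  apply IsGreatest.csSup_eq
  constructor
  · obtain ⟨x0, hx0⟩ := hcX ⟨0, by omega⟩
    obtain ⟨x1, hx1⟩ := hcX ⟨1, by omega⟩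
    have : Nonempty X := ⟨x0⟩
    let g : Fin m → ℝ := fun i => if i = ⟨0, by omega⟩ then 1 else 2
    have hg : ∀ i, 0 < g i := by intro i; simp only [g]; split_ifs <;> norm_num
    set N : ℝ := (Fintype.card X : ℝ) with hN
    have hNp : 0 < N := by rw [hN]; exact_mod_cast Fintype.card_pos
    have hSp : 0 < ∑ z, g (cX z) := Finset.sum_pos (fun z _ => hg _) Finset.univ_nonempty
    set S := ∑ z, g (cX z) with hS
    let l : Fin m → ℝ := fun i => g i * N / S
    have hl : ∀ i, 0 < l i := fun i => div_pos (mul_pos (hg i) hNp) hSp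
    let Q : X → ℝ := fun _ => N⁻¹
    let P : X → ℝ := fun x => l (cX x) * Q x
    have hQ : ∀ z, 0 < Q z := fun z => inv_pos.mpr hNp
    have hP : ∀ z, 0 < P z := fun z => mul_pos (hl _) (hQ z)
    have hQ1 : ∑ z, Q z = 1 := by
      simp only [Q, Finset.sum_const, Finset.card_univ, nsmul_eq_mul]
      exact mul_inv_cancel₀ hNp.ne'
    have hP1 : ∑ z, P z = 1 := by
      have : ∀ z, P z = g (cX z) / S := by
        intro z; simp only [P, l, Q]; field_simp
      simp_rw [this]
      rw [← Finset.sum_div]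
      exact div_self hSp.ne'
    have hne : P ≠ Q := by
      intro h
      have h0 : l (cX x0) * N⁻¹ = N⁻¹ := congrFun h x0
      have h1 : l (cX x1) * N⁻¹ = N⁻¹ := congrFun h x1
      have h2 : g (cX x0) = g (cX x1) := by
        have := h0.trans h1.symm
        simp only [l] at this
        field_simp at this
        exact this
      simp [g, hx0, hx1] at h2
    have key : ∀ a b : ℝ, 0 < a → 0 ≤ b → (a * b) ^ α * b ^ (1 - α) = a ^ α * b := by
      intro a b ha hb
      rcases hb.eq_or_lt with h | h
      · simp [← h, zero_rpow (show α ≠ 0 by linarith)]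
      · rw [mul_rpow ha.le hb, rpow_sub h, rpow_one]; field_simp
    have hgt := s17_gt α hα P Q hP hQ hP1 hQ1 hne
    have heq : ∑ y, (∑ z, K z y * P z) ^ α * (∑ z, K z y * Q z) ^ (1 - α)
        = ∑ z, P z ^ α * Q z ^ (1 - α) := by
      have e1 : ∀ y, (∑ z, K z y * P z) ^ α * (∑ z, K z y * Q z) ^ (1 - α)
          = ∑ z, K z y * (l (cX z) ^ α * Q z) := by
        intro y
        have : ∑ z, K z y * P z = l (cY y) * ∑ z, K z y * Q z := by
          rw [Finset.mul_sum]
          refine Finset.sum_congr rfl fun z _ => ?_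
          by_cases h : cX z = cY y
          · simp only [P, h]; ring
          · simp [hblock z y h]
        rw [this, key _ _ (hl _) (Finset.sum_nonneg fun z _ => mul_nonneg (hK0 z y) (hQ z).le),
          Finset.mul_sum]
        refine Finset.sum_congr rfl fun z _ => ?_
        by_cases h : cX z = cY y
        · simp only [h]; ring
        · simp [hblock z y h]
      simp_rw [e1]
      rw [Finset.sum_comm]
      refine Finset.sum_congr rfl fun z _ => ?_
      rw [← Finset.sum_mul, hK1, one_mul]
      exact (key _ _ (hl _) (hQ z).le).symm
    refine ⟨P, Q, hP, hQ, hP1, hQ1, hne, ?_⟩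
    rw [heq, div_self (mul_pos hα' (Real.log_pos hgt)).ne']
  · rintro r ⟨P, Q, hP, hQ, hP1, hQ1, hne, rfl⟩
    have hgt := s17_gt α hα P Q hP hQ hP1 hQ1 hne
    have hlog := Real.log_pos hgt
    apply div_le_one_of_le₀ _ (mul_pos hα' hlog).le
    apply mul_le_mul_of_nonneg_left _ hα'.le
    have h1 : ∑ y, (∑ z, K z y * P z) ^ α * (∑ z, K z y * Q z) ^ (1 - α)
        ≤ ∑ z, P z ^ α * Q z ^ (1 - α) := by
      calc _ ≤ ∑ y, ∑ z, K z y * (P z ^ α * Q z ^ (1 - α)) :=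
            Finset.sum_le_sum fun y _ =>
              s17_persp α hα P Q (fun z => K z y) hP hQ (fun z => hK0 z y)
        _ = _ := by
            rw [Finset.sum_comm]
            refine Finset.sum_congr rfl fun z _ => ?_
            rw [← Finset.sum_mul, hK1, one_mul]
    have h2 : 0 ≤ ∑ y, (∑ z, K z y * P z) ^ α * (∑ z, K z y * Q z) ^ (1 - α) :=
      Finset.sum_nonneg fun y _ => mul_nonneg
        (rpow_nonneg (Finset.sum_nonneg fun z _ => mul_nonneg (hK0 z y) (hP z).le) _)
        (rpow_nonneg (Finset.sum_nonneg fun z _ => mul_nonneg (hK0 z y) (hQ z).le) _)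
    rcases h2.eq_or_lt with h | h
    · rw [← h, Real.log_zero]; exact hlog.le
    · exact Real.log_le_log h h1
end
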